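/- arXiv:1908.04882 — 5 statements merged into one kernel-verified Lean document; each statement's English description precedes it below -/
import Mathlib

section
/- Let B be a finitely semi-graded K-algebra generated in degree 1 with B_0 = K. Define a relation ∼ on P(B) by [M] ∼ [M'] if and only if Gr(M) and Gr(M') are isomorphic as graded Gr(B)-modules. Then ∼ is an equivalence relation on P(B), for every point module M of B the graded module Gr(M) is a point module for the finitely graded algebra Gr(B), and the map from P(B)/∼ to P(Gr(B)) sending the ∼-class of [M] to the isomorphism class of Gr(M) is well defined and injective. -/
universe u v w

section

variable {K : Type u} {B : Type v} [Field K] [Ring B] [Algebra K B]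

/-- The standard filtration `F_n = (deg 0) ⊕ ⋯ ⊕ (deg n)` associated to a
semi-graduation of a `K`-module. -/
def sgFilt {M : Type*} [AddCommGroup M] [Module K M]
    (deg : ℕ → Submodule K M) (n : ℕ) : Submodule K M :=
  ⨆ k ∈ Set.Iic n, deg k

/-- `F_{n−1}`, with `F_{−1} = 0`. -/
def sgFiltPrev {M : Type*} [AddCommGroup M] [Module K M]
    (deg : ℕ → Submodule K M) : ℕ → Submodule K M
  | 0 => ⊥
  | (n + 1) => sgFilt deg n

/-- A point module for a finitely semi-graded `K`-algebra `B` with semi-graduation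
`Bdeg`: a cyclic `B`-module `M = ⊕_{n≥0} M_n` generated in degree 0, with
`B_p · M_q ⊆ M_0 ⊕ ⋯ ⊕ M_{p+q}` and `dim_K M_n = 1` for all `n`. -/
structure SGPointModule (Bdeg : ℕ → Submodule K B) where
  M : Type v
  [acg : AddCommGroup M]
  [modK : Module K M]
  [modB : Module B M]
  [tower : IsScalarTower K B M]
  deg : ℕ → Submodule K M
  internal : DirectSum.IsInternal deg
  smul_le : ∀ p q : ℕ, ∀ b ∈ Bdeg p, ∀ v ∈ deg q, b • v ∈ ⨆ k ∈ Set.Iic (p + q), deg k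
  cyclic : ∃ v ∈ deg 0, Submodule.span B {v} = ⊤
  dim_one : ∀ n : ℕ, Module.finrank K (deg n) = 1

attribute [instance] SGPointModule.acg SGPointModule.modK SGPointModule.modB
  SGPointModule.tower

/-- Isomorphism of point modules: a `B`-module isomorphism preserving the
semi-graduation. -/
def SGPointModule.Iso {Bdeg : ℕ → Submodule K B} (P P' : SGPointModule Bdeg) : Prop :=
  ∃ f : P.M ≃ₗ[B] P'.M,
    ∀ n : ℕ, Submodule.map ((f.restrictScalars K : P.M ≃ₗ[K] P'.M) : P.M →ₗ[K] P'.M)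
      (P.deg n) = P'.deg n

/-- The degree-`n` piece `F_n(M)/F_{n−1}(M)` of the associated graded module of a
point module. -/
abbrev SGPointModule.GrQuot {Bdeg : ℕ → Submodule K B} (P : SGPointModule Bdeg) (n : ℕ) :=
  (sgFilt P.deg n) ⧸ ((sgFiltPrev P.deg n).comap (sgFilt P.deg n).subtype)

/-- `Gr(M) ≅ Gr(M')` as graded `Gr(B)`-modules: a family of `K`-linear isomorphisms
`F_n(M)/F_{n−1}(M) ≃ F_n(M')/F_{n−1}(M')` compatible with the `Gr(B)`-action induced
by the `B`-action on representatives. -/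
def SGPointModule.GrIso {Bdeg : ℕ → Submodule K B} (P P' : SGPointModule Bdeg) : Prop :=
  ∃ g : ∀ n : ℕ, P.GrQuot n ≃ₗ[K] P'.GrQuot n,
    ∀ (p n : ℕ) (b : B) (hb : b ∈ sgFilt Bdeg p) (m : P.M) (hm : m ∈ sgFilt P.deg n)
      (m' : P'.M) (hm' : m' ∈ sgFilt P'.deg n),
      g n (Submodule.Quotient.mk ⟨m, hm⟩) = Submodule.Quotient.mk ⟨m', hm'⟩ →
      ∀ (h₁ : b • m ∈ sgFilt P.deg (p + n)) (h₂ : b • m' ∈ sgFilt P'.deg (p + n)),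
        g (p + n) (Submodule.Quotient.mk ⟨b • m, h₁⟩) =
          Submodule.Quotient.mk ⟨b • m', h₂⟩

/-- A point module for an ℕ-graded `K`-algebra `G` with grading `Gdeg`: an ℕ-graded
cyclic `G`-module generated in degree 0 whose components are one-dimensional. -/
structure GrPointModule (G : Type w) [Ring G] [Algebra K G]
    (Gdeg : ℕ → Submodule K G) where
  N : Type w
  [acg : AddCommGroup N]
  [modK : Module K N]
  [modG : Module G N]
  [tower : IsScalarTower K G N]
  deg : ℕ → Submodule K N
  internal : DirectSum.IsInternal deg
  smul_graded : ∀ p q : ℕ, ∀ u ∈ Gdeg p, ∀ v ∈ deg q, u • v ∈ deg (p + q)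
  cyclic : ∃ v ∈ deg 0, Submodule.span G {v} = ⊤
  dim_one : ∀ n : ℕ, Module.finrank K (deg n) = 1

attribute [instance] GrPointModule.acg GrPointModule.modK GrPointModule.modG
  GrPointModule.tower

/-- Isomorphism of graded point modules: a degree-preserving `G`-module
isomorphism. -/
def GrPointModule.Iso {G : Type w} [Ring G] [Algebra K G] {Gdeg : ℕ → Submodule K G}
    (Q Q' : GrPointModule G Gdeg) : Prop :=
  ∃ f : Q.N ≃ₗ[G] Q'.N,
    ∀ n : ℕ, Submodule.map ((f.restrictScalars K : Q.N ≃ₗ[K] Q'.N) : Q.N →ₗ[K] Q'.N)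
      (Q.deg n) = Q'.deg n

/-- `Q` realizes the associated graded module `Gr(M)` of the point module `P`, where
`gr` realizes the associated graded ring `Gr(B)`. -/
def RealizesGr {Bdeg : ℕ → Submodule K B} {G : Type w} [Ring G] [Algebra K G]
    (gr : ∀ p : ℕ, (sgFilt Bdeg p) →ₗ[K] G) (P : SGPointModule Bdeg)
    (Q : GrPointModule G (fun p : ℕ => LinearMap.range (gr p))) : Prop :=
  ∃ grM : ∀ n : ℕ, (sgFilt P.deg n) →ₗ[K] Q.N,
    (∀ n : ℕ, LinearMap.range (grM n) = Q.deg n) ∧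
    (∀ (n : ℕ) (m : P.M) (hm : m ∈ sgFilt P.deg n),
      grM n ⟨m, hm⟩ = 0 ↔ m ∈ sgFiltPrev P.deg n) ∧
    (∀ (p n : ℕ) (b : B) (m : P.M) (hb : b ∈ sgFilt Bdeg p) (hm : m ∈ sgFilt P.deg n)
      (hbm : b • m ∈ sgFilt P.deg (p + n)),
      gr p ⟨b, hb⟩ • grM n ⟨m, hm⟩ = grM (p + n) ⟨b • m, hbm⟩)

section filt
variable {M : Type*} [AddCommGroup M] [Module K M] (deg : ℕ → Submodule K M)

theorem deg_le_sgFilt {k n : ℕ} (h : k ≤ n) : deg k ≤ sgFilt deg n :=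
  le_iSup₂_of_le k h le_rfl

theorem sgFilt_le_iff {n : ℕ} {S : Submodule K M} :
    sgFilt deg n ≤ S ↔ ∀ k ≤ n, deg k ≤ S := by
  simp [sgFilt, iSup_le_iff]

theorem sgFilt_mono {m n : ℕ} (h : m ≤ n) : sgFilt deg m ≤ sgFilt deg n :=
  (sgFilt_le_iff deg).2 fun _ hk => deg_le_sgFilt deg (hk.trans h)

theorem sgFilt_zero : sgFilt deg 0 = deg 0 := by
  apply le_antisymm
  · rw [sgFilt_le_iff]
    intro k hk
    obtain rfl : k = 0 := by omega
    exact le_rfl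
  · exact deg_le_sgFilt deg le_rfl

theorem sgFilt_succ (n : ℕ) : sgFilt deg (n + 1) = sgFilt deg n ⊔ deg (n + 1) := by
  apply le_antisymm
  · rw [sgFilt_le_iff]
    intro k hk
    rcases Nat.lt_or_ge n k with h | h
    · obtain rfl : k = n + 1 := by omega
      exact le_sup_right
    · exact le_sup_of_le_left (deg_le_sgFilt deg h)
  · exact sup_le (sgFilt_mono deg (by omega)) (deg_le_sgFilt deg le_rfl)

theorem sgFiltPrev_le (n : ℕ) : sgFiltPrev deg n ≤ sgFilt deg n := by
  cases n with
  | zero => exact bot_le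
  | succ n => exact sgFilt_mono deg (by omega)

theorem sgFilt_disjoint (h : DirectSum.IsInternal deg) (n : ℕ) :
    Disjoint (sgFilt deg n) (deg (n + 1)) := by
  have := h.submodule_iSupIndep (n + 1)
  refine (this.mono_right ?_).symm
  rw [sgFilt_le_iff]
  intro k hk
  exact le_iSup₂_of_le k (by omega) le_rfl

theorem sgFilt_finrank (h : DirectSum.IsInternal deg)
    (h1 : ∀ n, Module.finrank K (deg n) = 1) (n : ℕ) :
    FiniteDimensional K (sgFilt deg n) ∧ Module.finrank K (sgFilt deg n) = n + 1 := by
  have hf : ∀ n, FiniteDimensional K (deg n) := fun n =>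
    Module.finite_of_finrank_pos (by rw [h1]; exact one_pos)
  induction n with
  | zero => rw [sgFilt_zero]; exact ⟨hf 0, h1 0⟩
  | succ n ih =>
    obtain ⟨i1, i2⟩ := ih
    have := hf (n + 1)
    rw [sgFilt_succ]
    refine ⟨inferInstance, ?_⟩
    have e := Submodule.finrank_sup_add_finrank_inf_eq (sgFilt deg n) (deg (n + 1))
    rw [(sgFilt_disjoint deg h n).eq_bot, finrank_bot, i2, h1] at e
    simpa using e

theorem grQuot_finrank (h : DirectSum.IsInternal deg)
    (h1 : ∀ n, Module.finrank K (deg n) = 1) (n : ℕ) :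
    Module.finrank K ((sgFilt deg n) ⧸ ((sgFiltPrev deg n).comap (sgFilt deg n).subtype)) = 1 := by
  obtain ⟨i1, i2⟩ := sgFilt_finrank deg h h1 n
  have e := Submodule.finrank_quotient_add_finrank
    ((sgFiltPrev deg n).comap (sgFilt deg n).subtype)
  have e2 : Module.finrank K ((sgFiltPrev deg n).comap (sgFilt deg n).subtype)
      = Module.finrank K (sgFiltPrev deg n) :=
    (Submodule.comapSubtypeEquivOfLe (sgFiltPrev_le deg n)).finrank_eq
  have e3 : Module.finrank K (sgFiltPrev deg n) = n := by
    cases n with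
    | zero => exact finrank_bot K M
    | succ n => exact (sgFilt_finrank deg h h1 n).2
  omega

variable [Module B M] [IsScalarTower K B M] {Bdeg : ℕ → Submodule K B}

/-- The map `b ↦ b • v` as a `K`-linear map. -/
def actOn (B : Type*) [Ring B] [Algebra K B] {M : Type*} [AddCommGroup M] [Module K M]
    [Module B M] [IsScalarTower K B M] (v : M) : B →ₗ[K] M :=
  (LinearMap.toSpanSingleton B M v).restrictScalars K

@[simp] theorem actOn_apply (v : M) (b : B) : actOn (K := K) B v b = b • v := rfl

/-- The map `v ↦ b • v` as a `K`-linear map. -/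
def actBy (K : Type*) [Field K] {B : Type*} [Ring B] [Algebra K B] (M : Type*) [AddCommGroup M]
    [Module K M] [Module B M] [IsScalarTower K B M] (b : B) : M →ₗ[K] M where
  toFun v := b • v
  map_add' := smul_add b
  map_smul' k v := by
    rw [RingHom.id_apply, ← algebraMap_smul B k v, ← algebraMap_smul B k (b • v), smul_smul,
      smul_smul, Algebra.commutes]

@[simp] theorem actBy_apply (v : M) (b : B) : actBy K M b v = b • v := rfl

theorem filt_smul_mem
    (hs : ∀ p q : ℕ, ∀ b ∈ Bdeg p, ∀ v ∈ deg q, b • v ∈ ⨆ k ∈ Set.Iic (p + q), deg k)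
    {p q : ℕ} {b : B} (hb : b ∈ sgFilt Bdeg p) {v : M} (hv : v ∈ sgFilt deg q) :
    b • v ∈ sgFilt deg (p + q) := by
  have h1 : sgFilt deg q ≤ (sgFilt deg (p + q)).comap (actBy K M b) := by
    rw [sgFilt_le_iff]
    intro j hj w hw
    have h2 : sgFilt Bdeg p ≤ (sgFilt deg (p + q)).comap (actOn B w) := by
      rw [sgFilt_le_iff]
      intro i hi c hc
      exact sgFilt_mono deg (Nat.add_le_add hi hj) (hs i j c hc w hw)
    exact h2 hb
  exact h1 hv

theorem filt_smul_memPrev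
    (hs : ∀ p q : ℕ, ∀ b ∈ Bdeg p, ∀ v ∈ deg q, b • v ∈ ⨆ k ∈ Set.Iic (p + q), deg k)
    {p q : ℕ} {b : B} (hb : b ∈ sgFilt Bdeg p) {v : M} (hv : v ∈ sgFiltPrev deg q) :
    b • v ∈ sgFiltPrev deg (p + q) := by
  cases q with
  | zero =>
    obtain rfl : v = 0 := hv
    simp
  | succ q => exact filt_smul_mem deg hs hb hv

theorem filt_prev_smul_mem
    (hs : ∀ p q : ℕ, ∀ b ∈ Bdeg p, ∀ v ∈ deg q, b • v ∈ ⨆ k ∈ Set.Iic (p + q), deg k)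
    {p : ℕ} {b : B} (hb : b ∈ sgFiltPrev Bdeg p) {v : M} (hv : v ∈ sgFilt deg 0) :
    b • v ∈ sgFiltPrev deg p := by
  cases p with
  | zero =>
    obtain rfl : b = 0 := hb
    simp
  | succ p => exact filt_smul_mem deg hs (q := 0) hb hv

/-- Key fact: the filtration of a point module is the one induced by its generator. -/
theorem filt_eq_map (hdeg : DirectSum.IsInternal deg)
    (hs : ∀ p q : ℕ, ∀ b ∈ Bdeg p, ∀ v ∈ deg q, b • v ∈ ⨆ k ∈ Set.Iic (p + q), deg k)
    (h1 : ∀ n : ℕ, Module.finrank K (deg n) = 1)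
    (hmul : ∀ m n : ℕ, ∀ a b : B, a ∈ Bdeg m → b ∈ Bdeg n →
      a * b ∈ ⨆ k ∈ Set.Iic (m + n), Bdeg k)
    (hdeg0 : Bdeg 0 = Submodule.span K {(1 : B)})
    (hgen : Algebra.adjoin K (Bdeg 1 : Set B) = ⊤)
    {v : M} (hv : v ∈ deg 0) (hcyc : Submodule.span B {v} = ⊤) (n : ℕ) :
    (sgFilt Bdeg n).map (actOn B v) = sgFilt deg n := by
  have hone : ∀ n, (1 : B) ∈ sgFilt Bdeg n := fun n => deg_le_sgFilt Bdeg (Nat.zero_le n)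
    (by rw [hdeg0]; exact Submodule.mem_span_singleton_self 1)
  have hle : ∀ n, (sgFilt Bdeg n).map (actOn B v) ≤ sgFilt deg n := by
    rintro n _ ⟨b, hb, rfl⟩
    exact filt_smul_mem deg hs (q := 0) hb (deg_le_sgFilt deg le_rfl hv)
  have hv0 : v ≠ 0 := by
    rintro rfl
    have hsub : Subsingleton M := by
      rw [Submodule.span_singleton_eq_bot.2 rfl] at hcyc
      exact (Submodule.subsingleton_iff B).1 (subsingleton_of_bot_eq_top hcyc)
    have := h1 0
    rw [Module.finrank_zero_of_subsingleton] at this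
    exact zero_ne_one this
  induction n with
  | zero =>
    obtain ⟨i1, i2⟩ := sgFilt_finrank deg hdeg h1 0
    apply Submodule.eq_of_le_of_finrank_le (hle 0)
    rw [i2]
    have : FiniteDimensional K ((sgFilt Bdeg 0).map (actOn B v)) :=
      Submodule.finiteDimensional_of_le (hle 0)
    have hne : Nontrivial ((sgFilt Bdeg 0).map (actOn B v)) := by
      rw [Submodule.nontrivial_iff_ne_bot, Submodule.ne_bot_iff]
      exact ⟨v, ⟨1, hone 0, one_smul B v⟩, hv0⟩
    exact Module.finrank_pos
  | succ n ih =>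
    by_contra hcon
    obtain ⟨i1, i2⟩ := sgFilt_finrank deg hdeg h1 (n + 1)
    obtain ⟨j1, j2⟩ := sgFilt_finrank deg hdeg h1 n
    have hlt := Submodule.finrank_lt_finrank_of_lt (lt_of_le_of_ne (hle (n + 1)) hcon)
    have : FiniteDimensional K ((sgFilt Bdeg (n + 1)).map (actOn B v)) :=
      Submodule.finiteDimensional_of_le (hle (n + 1))
    have heq : sgFilt deg n = (sgFilt Bdeg (n + 1)).map (actOn B v) := by
      apply Submodule.eq_of_le_of_finrank_le
      · rw [← ih]
        exact Submodule.map_mono (sgFilt_mono Bdeg (by omega))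
      · omega
    have hst : ∀ b ∈ Bdeg 1, ∀ m ∈ sgFilt deg n, b • m ∈ sgFilt deg n := by
      intro b hb m hm
      rw [← ih] at hm
      obtain ⟨c, hc, rfl⟩ := hm
      rw [heq]
      refine ⟨b * c, ?_, mul_smul b c v⟩
      rw [Nat.add_comm]
      exact filt_smul_mem Bdeg (fun p q b hb v hv => hmul p q b v hb hv)
        (deg_le_sgFilt Bdeg le_rfl hb) hc
    have hst2 : ∀ b : B, ∀ m ∈ sgFilt deg n, b • m ∈ sgFilt deg n := by
      intro b
      have hb : b ∈ Algebra.adjoin K (Bdeg 1 : Set B) := by rw [hgen]; trivial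
      induction hb using Algebra.adjoin_induction with
      | mem x hx => exact hst x hx
      | algebraMap r =>
        intro m hm
        rw [algebraMap_smul]
        exact Submodule.smul_mem _ r hm
      | add x y _ _ hx hy =>
        intro m hm
        rw [add_smul]
        exact add_mem (hx m hm) (hy m hm)
      | mul x y _ _ hx hy =>
        intro m hm
        rw [mul_smul]
        exact hx _ (hy m hm)
    have htop : sgFilt deg (n + 1) ≤ sgFilt deg n := by
      intro m _
      have : m ∈ Submodule.span B {v} := by rw [hcyc]; trivial
      obtain ⟨b, rfl⟩ := Submodule.mem_span_singleton.1 this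
      exact hst2 b v (deg_le_sgFilt deg (Nat.zero_le n) hv)
    have := Submodule.finrank_mono htop
    omega

end filt

open DirectSum in
theorem exists_assemble {V : Type*} [AddCommGroup V] [Module K V] (D : ℕ → Submodule K V)
    (hD : DirectSum.IsInternal D) (Q : ℕ → Type*) [∀ n, AddCommGroup (Q n)] [∀ n, Module K (Q n)]
    (φ : ∀ n, D n →ₗ[K] Q n) (hφ : ∀ n, Function.Surjective (φ n)) :
    ∃ ψ : V →ₗ[K] ⨁ n, Q n, Function.Surjective ψ ∧
      ∀ n (x : D n), ψ x = DirectSum.lof K ℕ Q n (φ n x) := by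
  let e : (⨁ n, D n) ≃ₗ[K] V := LinearEquiv.ofBijective (DirectSum.coeLinearMap D) hD
  let T : (⨁ n, D n) →ₗ[K] ⨁ n, Q n :=
    DirectSum.toModule K ℕ _ fun n => DirectSum.lof K ℕ Q n ∘ₗ φ n
  have key : ∀ n (x : D n), (T ∘ₗ e.symm.toLinearMap) x = DirectSum.lof K ℕ Q n (φ n x) := by
    intro n x
    have h1 : e (DirectSum.lof K ℕ (fun n => D n) n x) = x :=
      DirectSum.coeLinearMap_lof D n x
    have h2 : e.symm (x : V) = DirectSum.lof K ℕ (fun n => D n) n x := by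
      rw [LinearEquiv.symm_apply_eq, h1]
    rw [LinearMap.comp_apply, LinearEquiv.coe_coe, h2]
    exact DirectSum.toModule_lof (M := fun n => D n) K n x
  refine ⟨T ∘ₗ e.symm.toLinearMap, ?_, key⟩
  intro y
  induction y using DirectSum.induction_on with
  | zero => exact ⟨0, map_zero _⟩
  | of n y =>
    obtain ⟨x, rfl⟩ := hφ n y
    exact ⟨x, key n x⟩
  | add y z hy hz =>
    obtain ⟨a, rfl⟩ := hy
    obtain ⟨b, rfl⟩ := hz
    exact ⟨a + b, map_add _ _ _⟩

open DirectSum in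
theorem isInternal_of_equiv {N : Type*} [AddCommGroup N] [Module K N] (D : ℕ → Submodule K N)
    (Q : ℕ → Type*) [∀ n, AddCommGroup (Q n)] [∀ n, Module K (Q n)]
    (e : N ≃ₗ[K] ⨁ n, Q n)
    (hD : ∀ n, D n = (LinearMap.range (DirectSum.lof K ℕ Q n)).map e.symm.toLinearMap) :
    DirectSum.IsInternal D := by
  let c : ∀ n, Q n →ₗ[K] D n := fun n =>
    (e.symm.toLinearMap ∘ₗ DirectSum.lof K ℕ Q n).codRestrict (D n) (fun x => by
      rw [hD]; exact ⟨_, ⟨x, rfl⟩, rfl⟩)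
  have hc : ∀ n, Function.Bijective (c n) := by
    intro n
    constructor
    · intro x y hxy
      have h : e.symm (DirectSum.lof K ℕ Q n x) = e.symm (DirectSum.lof K ℕ Q n y) :=
        congrArg Subtype.val hxy
      exact DirectSum.of_injective (β := Q) n (e.symm.injective h)
    · rintro ⟨y, hy⟩
      have hy2 := hy
      rw [hD] at hy2
      obtain ⟨_, ⟨x, rfl⟩, rfl⟩ := hy2
      exact ⟨x, rfl⟩
  let E : (⨁ n, Q n) ≃ₗ[K] ⨁ n, D n :=
    DFinsupp.mapRange.linearEquiv fun n => LinearEquiv.ofBijective (c n) (hc n)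
  have hcomp : (DirectSum.coeLinearMap D) ∘ₗ E.toLinearMap = e.symm.toLinearMap := by
    apply DirectSum.linearMap_ext
    intro n
    ext x
    have : E (DirectSum.lof K ℕ Q n x) = DirectSum.lof K ℕ (fun n => D n) n (c n x) := by
      exact DFinsupp.mapRange_single (hf := fun i => map_zero (c i))
    simp only [LinearMap.comp_apply, LinearEquiv.coe_coe, this]
    exact DirectSum.coeLinearMap_lof D n (c n x)
  have hfun : (DirectSum.coeLinearMap D : (⨁ n, D n) → N) = e.symm ∘ E.symm := by
    funext y
    have := LinearMap.congr_fun hcomp (E.symm y)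
    simpa using this
  change Function.Bijective (DirectSum.coeLinearMap D)
  rw [hfun]
  exact e.symm.bijective.comp E.symm.bijective

section gr
variable {Bdeg : ℕ → Submodule K B} {G : Type w} [Ring G] [Algebra K G]
  {gr : ∀ p : ℕ, (sgFilt Bdeg p) →ₗ[K] G}

theorem gr_ext (hGinternal : DirectSum.IsInternal (fun p : ℕ => LinearMap.range (gr p)))
    {V : Type*} [AddCommMonoid V] [Module K V] {f g : G →ₗ[K] V}
    (h : ∀ p (b : B) (hb : b ∈ sgFilt Bdeg p), f (gr p ⟨b, hb⟩) = g (gr p ⟨b, hb⟩)) : f = g := by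
  have h1 := hGinternal.submodule_iSup_eq_top
  have h2 : (⨆ p, LinearMap.range (gr p)) ≤ LinearMap.eqLocus f g := by
    rw [iSup_le_iff]
    rintro p _ ⟨⟨b, hb⟩, rfl⟩
    exact h p b hb
  rw [h1] at h2
  ext u
  exact h2 (Submodule.mem_top (x := u))

theorem SGPointModule.filt_smul (P : SGPointModule Bdeg) {p q : ℕ} {b : B}
    (hb : b ∈ sgFilt Bdeg p) {m : P.M} (hm : m ∈ sgFilt P.deg q) :
    b • m ∈ sgFilt P.deg (p + q) := filt_smul_mem P.deg P.smul_le hb hm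

theorem SGPointModule.filt_smul_gen (P : SGPointModule Bdeg) {p : ℕ} {b : B}
    (hb : b ∈ sgFilt Bdeg p) {m : P.M} (hm : m ∈ P.deg 0) :
    b • m ∈ sgFilt P.deg p := P.filt_smul (q := 0) hb (deg_le_sgFilt P.deg le_rfl hm)

theorem SGPointModule.lof_eq_zero (P : SGPointModule Bdeg) (n : ℕ) (m : P.M)
    (hm : m ∈ sgFilt P.deg n) :
    DirectSum.lof K ℕ P.GrQuot n (Submodule.Quotient.mk ⟨m, hm⟩) = 0 ↔
      m ∈ sgFiltPrev P.deg n := by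
  have h1 : DirectSum.lof K ℕ P.GrQuot n (Submodule.Quotient.mk ⟨m, hm⟩) = 0 ↔
      (Submodule.Quotient.mk ⟨m, hm⟩ : P.GrQuot n) = 0 :=
    map_eq_zero_iff (DirectSum.lof K ℕ P.GrQuot n) (DirectSum.of_injective (β := P.GrQuot) n)
  rw [h1, Submodule.Quotient.mk_eq_zero]
  rfl

open DirectSum in
theorem exists_psi
    (hGinternal : DirectSum.IsInternal (fun p : ℕ => LinearMap.range (gr p)))
    (hker : ∀ (p : ℕ) (a : B) (ha : a ∈ sgFilt Bdeg p),
      gr p ⟨a, ha⟩ = 0 ↔ a ∈ sgFiltPrev Bdeg p)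
    (P : SGPointModule Bdeg) (v : P.M) (hv : v ∈ P.deg 0)
    (hF : ∀ n, (sgFilt Bdeg n).map (actOn B v) = sgFilt P.deg n) :
    ∃ ψ : G →ₗ[K] ⨁ n, P.GrQuot n, Function.Surjective ψ ∧
      ∀ p (b : B) (hb : b ∈ sgFilt Bdeg p), ψ (gr p ⟨b, hb⟩) =
        DirectSum.lof K ℕ P.GrQuot p (Submodule.Quotient.mk ⟨b • v, P.filt_smul_gen hb hv⟩) := by
  let r : ∀ p, sgFilt Bdeg p →ₗ[K] P.GrQuot p := fun p =>
    (Submodule.mkQ _) ∘ₗ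
      ((actOn B v).restrict (p := sgFilt Bdeg p) (q := sgFilt P.deg p)
        (fun b hb => P.filt_smul_gen hb hv))
  have hr : ∀ p, ∃ φ : LinearMap.range (gr p) →ₗ[K] P.GrQuot p,
      φ ∘ₗ (gr p).rangeRestrict = r p := by
    intro p
    obtain ⟨s, hs⟩ := (gr p).rangeRestrict.exists_rightInverse_of_surjective
      (LinearMap.range_rangeRestrict _)
    refine ⟨r p ∘ₗ s, ?_⟩
    ext1 b
    have h1 : (gr p).rangeRestrict (s ((gr p).rangeRestrict b)) = (gr p).rangeRestrict b :=
      LinearMap.congr_fun hs _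
    have h2 : gr p (s ((gr p).rangeRestrict b) - b) = 0 := by
      rw [map_sub, sub_eq_zero]
      exact congrArg Subtype.val h1
    rw [LinearMap.comp_apply, LinearMap.comp_apply, ← sub_eq_zero, ← map_sub]
    generalize s ((gr p).rangeRestrict b) - b = c at h2
    obtain ⟨c, hc⟩ := c
    rw [hker] at h2
    change Submodule.Quotient.mk (⟨c • v, P.filt_smul_gen hc hv⟩ : sgFilt P.deg p) = 0
    rw [Submodule.Quotient.mk_eq_zero]
    exact filt_prev_smul_mem P.deg P.smul_le h2 (deg_le_sgFilt P.deg le_rfl hv)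
  choose φ hφ using hr
  obtain ⟨ψ, h1, h2⟩ := exists_assemble _ hGinternal P.GrQuot φ (by
    intro n y
    obtain ⟨⟨m, hm⟩, rfl⟩ := Submodule.Quotient.mk_surjective _ y
    have hm2 := hm
    rw [← hF] at hm2
    obtain ⟨b, hb, rfl⟩ := hm2
    exact ⟨(gr n).rangeRestrict ⟨b, hb⟩, LinearMap.congr_fun (hφ n) ⟨b, hb⟩⟩)
  refine ⟨ψ, h1, ?_⟩
  intro p b hb
  have := h2 p ((gr p).rangeRestrict ⟨b, hb⟩)
  rw [show φ p ((gr p).rangeRestrict ⟨b, hb⟩) = r p ⟨b, hb⟩ from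
    LinearMap.congr_fun (hφ p) ⟨b, hb⟩] at this
  exact this

open DirectSum in
theorem exists_ideal
    (hmul : ∀ m n : ℕ, ∀ a b : B, a ∈ Bdeg m → b ∈ Bdeg n →
      a * b ∈ ⨆ k ∈ Set.Iic (m + n), Bdeg k)
    (hGinternal : DirectSum.IsInternal (fun p : ℕ => LinearMap.range (gr p)))
    (hgrmul : ∀ (p q : ℕ) (a b : B) (ha : a ∈ sgFilt Bdeg p) (hb : b ∈ sgFilt Bdeg q)
      (hab : a * b ∈ sgFilt Bdeg (p + q)),
      gr p ⟨a, ha⟩ * gr q ⟨b, hb⟩ = gr (p + q) ⟨a * b, hab⟩)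
    (P : SGPointModule Bdeg) (v : P.M) (hv : v ∈ P.deg 0)
    (ψ : G →ₗ[K] ⨁ n, P.GrQuot n)
    (hψ : ∀ p (b : B) (hb : b ∈ sgFilt Bdeg p), ψ (gr p ⟨b, hb⟩) =
        DirectSum.lof K ℕ P.GrQuot p (Submodule.Quotient.mk ⟨b • v, P.filt_smul_gen hb hv⟩)) :
    ∃ J : Submodule G G, ∀ u, u ∈ J ↔ ψ u = 0 := by
  have key : ∀ p (b : B) (hb : b ∈ sgFilt Bdeg p), ∃ L : (⨁ n, P.GrQuot n) →ₗ[K] ⨁ n, P.GrQuot n,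
      ∀ u, ψ (gr p ⟨b, hb⟩ * u) = L (ψ u) := by
    intro p b hb
    let l : ∀ q, P.GrQuot q →ₗ[K] P.GrQuot (p + q) := fun q =>
      Submodule.mapQ _ _ ((actBy K P.M b).restrict (p := sgFilt P.deg q)
        (q := sgFilt P.deg (p + q)) (fun m hm => P.filt_smul hb hm))
        (fun x hx => filt_smul_memPrev P.deg P.smul_le hb hx)
    let L : (⨁ n, P.GrQuot n) →ₗ[K] ⨁ n, P.GrQuot n :=
      DirectSum.toModule K ℕ _ fun q => DirectSum.lof K ℕ P.GrQuot (p + q) ∘ₗ l q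
    refine ⟨L, ?_⟩
    have : ψ ∘ₗ LinearMap.mulLeft K (gr p ⟨b, hb⟩) = L ∘ₗ ψ := by
      apply gr_ext hGinternal
      intro q c hc
      have hbc : b * c ∈ sgFilt Bdeg (p + q) :=
        filt_smul_mem Bdeg (fun p q b hb v hv => hmul p q b v hb hv) hb hc
      rw [LinearMap.comp_apply, LinearMap.comp_apply, LinearMap.mulLeft_apply,
        hgrmul p q b c hb hc hbc, hψ, hψ, DirectSum.toModule_lof]
      change _ = DirectSum.lof K ℕ P.GrQuot (p + q) (Submodule.Quotient.mk _)
      congr 2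
      exact Subtype.ext (mul_smul b c v)
    exact fun u => LinearMap.congr_fun this u
  refine ⟨{ carrier := {u | ψ u = 0}, add_mem' := ?_, zero_mem' := map_zero _, smul_mem' := ?_ },
    fun u => Iff.rfl⟩
  · intro a b ha hb
    simp only [Set.mem_ofPred_eq] at ha hb ⊢
    rw [map_add, ha, hb, add_zero]
  · intro g u hu
    simp only [Set.mem_ofPred_eq] at hu ⊢
    have : ψ ∘ₗ LinearMap.mulRight K u = 0 := by
      apply gr_ext hGinternal
      intro p b hb
      obtain ⟨L, hL⟩ := key p b hb
      rw [LinearMap.comp_apply, LinearMap.mulRight_apply, hL, hu, map_zero]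
      rfl
    exact LinearMap.congr_fun this g



theorem exists_quotEquiv_aux {W : Type*} [AddCommGroup W] [Module K W]
    (ψ : G →ₗ[K] W) (hsurj : Function.Surjective ψ)
    (J : Submodule G G) (hJ : ∀ u, u ∈ J ↔ ψ u = 0) :
    ∃ e : (G ⧸ J) ≃ₗ[K] W, ∀ u : G, e (Submodule.Quotient.mk u) = ψ u := by
  have hk : J.restrictScalars K = LinearMap.ker ψ := by
    ext u
    rw [Submodule.restrictScalars_mem, hJ, LinearMap.mem_ker]
  refine ⟨(Submodule.Quotient.restrictScalarsEquiv K J).symm ≪≫ₗ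
    (Submodule.quotEquivOfEq _ _ hk) ≪≫ₗ ψ.quotKerEquivOfSurjective hsurj, fun u => ?_⟩
  simp only [LinearEquiv.trans_apply]
  have h1 : (Submodule.Quotient.restrictScalarsEquiv K J).symm (Submodule.Quotient.mk u) =
    Submodule.Quotient.mk u := rfl
  rw [h1, Submodule.quotEquivOfEq_mk, LinearMap.quotKerEquivOfSurjective_apply_mk]

theorem exists_quotEquiv_aux2 {W : Type*} [AddCommMonoid W] [Module K W]
    (ψ : G →ₗ[K] W) (hsurj : Function.Surjective ψ)
    (J : Submodule G G) (hJ : ∀ u, u ∈ J ↔ ψ u = 0) :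
    ∃ e : (G ⧸ J) ≃ₗ[K] W, ∀ u : G, e (Submodule.Quotient.mk u) = ψ u := by
  letI := Module.addCommMonoidToAddCommGroup K (M := W)
  exact exists_quotEquiv_aux ψ hsurj J hJ

open DirectSum in
theorem exists_quotEquiv (P : SGPointModule Bdeg)
    (ψ : G →ₗ[K] ⨁ n, P.GrQuot n) (hsurj : Function.Surjective ψ)
    (J : Submodule G G) (hJ : ∀ u, u ∈ J ↔ ψ u = 0) :
    ∃ e : (G ⧸ J) ≃ₗ[K] ⨁ n, P.GrQuot n, ∀ u : G, e (Submodule.Quotient.mk u) = ψ u :=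
  exists_quotEquiv_aux2 ψ hsurj J hJ

/-- The degree pieces of `G ⧸ J`. -/
def quotDeg (gr : ∀ p : ℕ, (sgFilt Bdeg p) →ₗ[K] G) (J : Submodule G G) (n : ℕ) :
    Submodule K (G ⧸ J) :=
  (LinearMap.range (gr n)).map (J.mkQ.restrictScalars K)

open DirectSum in
theorem quotDeg_eq (P : SGPointModule Bdeg) (v : P.M) (hv : v ∈ P.deg 0)
    (hF : ∀ n, (sgFilt Bdeg n).map (actOn B v) = sgFilt P.deg n)
    (ψ : G →ₗ[K] ⨁ n, P.GrQuot n)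
    (hψ : ∀ p (b : B) (hb : b ∈ sgFilt Bdeg p), ψ (gr p ⟨b, hb⟩) =
        DirectSum.lof K ℕ P.GrQuot p (Submodule.Quotient.mk ⟨b • v, P.filt_smul_gen hb hv⟩))
    (J : Submodule G G) (e : (G ⧸ J) ≃ₗ[K] ⨁ n, P.GrQuot n)
    (he : ∀ u : G, e (Submodule.Quotient.mk u) = ψ u) (n : ℕ) :
    quotDeg gr J n = (LinearMap.range (DirectSum.lof K ℕ P.GrQuot n)).map e.symm.toLinearMap := by
  apply le_antisymm
  · rintro _ ⟨_, ⟨⟨b, hb⟩, rfl⟩, rfl⟩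
    refine ⟨_, ⟨Submodule.Quotient.mk ⟨b • v, P.filt_smul_gen hb hv⟩, rfl⟩, ?_⟩
    rw [← hψ n b hb]
    exact (LinearEquiv.symm_apply_eq e).2 (he _).symm
  · rintro _ ⟨_, ⟨y, rfl⟩, rfl⟩
    obtain ⟨⟨m, hm⟩, rfl⟩ := Submodule.Quotient.mk_surjective _ y
    have hm2 := hm
    rw [← hF] at hm2
    obtain ⟨b, hb, rfl⟩ := hm2
    refine ⟨gr n ⟨b, hb⟩, ⟨_, rfl⟩, ?_⟩
    refine ((LinearEquiv.symm_apply_eq e).2 ?_).symm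
    exact ((he _).trans (hψ n b hb)).symm

open DirectSum in
/-- The associated graded point module, realized as a quotient of `G`. -/
noncomputable def mkGr
    (hmul : ∀ m n : ℕ, ∀ a b : B, a ∈ Bdeg m → b ∈ Bdeg n →
      a * b ∈ ⨆ k ∈ Set.Iic (m + n), Bdeg k)
    (hgrmul : ∀ (p q : ℕ) (a b : B) (ha : a ∈ sgFilt Bdeg p) (hb : b ∈ sgFilt Bdeg q)
      (hab : a * b ∈ sgFilt Bdeg (p + q)),
      gr p ⟨a, ha⟩ * gr q ⟨b, hb⟩ = gr (p + q) ⟨a * b, hab⟩)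
    (hone : (1 : G) ∈ LinearMap.range (gr 0))
    (P : SGPointModule Bdeg) (v : P.M) (hv : v ∈ P.deg 0)
    (hF : ∀ n, (sgFilt Bdeg n).map (actOn B v) = sgFilt P.deg n)
    (ψ : G →ₗ[K] ⨁ n, P.GrQuot n) (hsurj : Function.Surjective ψ)
    (hψ : ∀ p (b : B) (hb : b ∈ sgFilt Bdeg p), ψ (gr p ⟨b, hb⟩) =
        DirectSum.lof K ℕ P.GrQuot p (Submodule.Quotient.mk ⟨b • v, P.filt_smul_gen hb hv⟩))
    (J : Submodule G G) (hJ : ∀ u, u ∈ J ↔ ψ u = 0) :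
    GrPointModule G (fun p : ℕ => LinearMap.range (gr p)) where
  N := G ⧸ J
  deg := quotDeg gr J
  internal := by
    obtain ⟨e, he⟩ := exists_quotEquiv P ψ hsurj J hJ
    exact isInternal_of_equiv _ P.GrQuot e (quotDeg_eq P v hv hF ψ hψ J e he)
  smul_graded := by
    rintro p q _ ⟨⟨b, hb⟩, rfl⟩ _ ⟨_, ⟨⟨c, hc⟩, rfl⟩, rfl⟩
    have hbc : b * c ∈ sgFilt Bdeg (p + q) :=
      filt_smul_mem Bdeg (fun p q b hb v hv => hmul p q b v hb hv) hb hc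
    refine ⟨_, ⟨⟨b * c, hbc⟩, rfl⟩, ?_⟩
    rw [← hgrmul p q b c hb hc hbc]
    rfl
  cyclic := by
    refine ⟨Submodule.Quotient.mk 1, ⟨1, hone, rfl⟩, ?_⟩
    rw [eq_top_iff]
    intro y _
    obtain ⟨u, rfl⟩ := Submodule.Quotient.mk_surjective _ y
    refine Submodule.mem_span_singleton.2 ⟨u, ?_⟩
    rw [← Submodule.Quotient.mk_smul, smul_eq_mul, mul_one]
  dim_one := by
    intro n
    obtain ⟨e, he⟩ := exists_quotEquiv P ψ hsurj J hJ
    rw [quotDeg_eq P v hv hF ψ hψ J e he, ← LinearMap.range_comp,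
      LinearMap.finrank_range_of_inj]
    · exact grQuot_finrank P.deg P.internal P.dim_one n
    · intro x y hxy
      exact DirectSum.of_injective (β := P.GrQuot) n (e.symm.injective hxy)

open DirectSum in
theorem mkGr_realizes
    (hmul : ∀ m n : ℕ, ∀ a b : B, a ∈ Bdeg m → b ∈ Bdeg n →
      a * b ∈ ⨆ k ∈ Set.Iic (m + n), Bdeg k)
    (hgrmul : ∀ (p q : ℕ) (a b : B) (ha : a ∈ sgFilt Bdeg p) (hb : b ∈ sgFilt Bdeg q)
      (hab : a * b ∈ sgFilt Bdeg (p + q)),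
      gr p ⟨a, ha⟩ * gr q ⟨b, hb⟩ = gr (p + q) ⟨a * b, hab⟩)
    (hone : (1 : G) ∈ LinearMap.range (gr 0))
    (P : SGPointModule Bdeg) (v : P.M) (hv : v ∈ P.deg 0)
    (hF : ∀ n, (sgFilt Bdeg n).map (actOn B v) = sgFilt P.deg n)
    (ψ : G →ₗ[K] ⨁ n, P.GrQuot n) (hsurj : Function.Surjective ψ)
    (hψ : ∀ p (b : B) (hb : b ∈ sgFilt Bdeg p), ψ (gr p ⟨b, hb⟩) =
        DirectSum.lof K ℕ P.GrQuot p (Submodule.Quotient.mk ⟨b • v, P.filt_smul_gen hb hv⟩))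
    (J : Submodule G G) (hJ : ∀ u, u ∈ J ↔ ψ u = 0) :
    RealizesGr gr P (mkGr hmul hgrmul hone P v hv hF ψ hsurj hψ J hJ) := by
  have hz : ∀ n b (hb : b ∈ sgFilt Bdeg n),
      (Submodule.Quotient.mk (gr n ⟨b, hb⟩) : G ⧸ J) = 0 ↔ b • v ∈ sgFiltPrev P.deg n := by
    intro n b hb
    rw [Submodule.Quotient.mk_eq_zero, hJ, hψ, P.lof_eq_zero]
  have hex : ∀ n, ∃ f : (sgFilt P.deg n) →ₗ[K] G ⧸ J, ∀ b (hb : b ∈ sgFilt Bdeg n),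
      f ⟨b • v, P.filt_smul_gen hb hv⟩ = Submodule.Quotient.mk (gr n ⟨b, hb⟩) := by
    intro n
    let a := (actOn B v).restrict (p := sgFilt Bdeg n) (q := sgFilt P.deg n)
        (fun b hb => P.filt_smul_gen hb hv)
    have ha : LinearMap.range a = ⊤ := by
      rw [LinearMap.range_eq_top]
      rintro ⟨m, hm⟩
      have hm2 := hm
      rw [← hF] at hm2
      obtain ⟨b, hb, rfl⟩ := hm2
      exact ⟨⟨b, hb⟩, rfl⟩
    obtain ⟨s, hs⟩ := a.exists_rightInverse_of_surjective ha
    refine ⟨(J.mkQ.restrictScalars K) ∘ₗ gr n ∘ₗ s, ?_⟩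
    intro b hb
    have h1 : a (s ⟨b • v, P.filt_smul_gen hb hv⟩) = ⟨b • v, P.filt_smul_gen hb hv⟩ :=
      LinearMap.congr_fun hs _
    obtain ⟨c, hc⟩ : ∃ c, s ⟨b • v, P.filt_smul_gen hb hv⟩ = c := ⟨_, rfl⟩
    rw [LinearMap.comp_apply, LinearMap.comp_apply, hc]
    rw [hc] at h1
    obtain ⟨c, hc'⟩ := c
    have h2 : c • v = b • v := congrArg Subtype.val h1
    change Submodule.Quotient.mk (gr n ⟨c, hc'⟩) = _
    rw [← sub_eq_zero, ← Submodule.Quotient.mk_sub, ← map_sub]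
    have := (hz n (c - b) (sub_mem hc' hb)).2 (by rw [sub_smul, h2, sub_self]; exact zero_mem _)
    exact this
  choose f hf using hex
  refine ⟨f, ?_, ?_, ?_⟩
  · intro n
    apply le_antisymm
    · rintro _ ⟨⟨m, hm⟩, rfl⟩
      have hm2 := hm
      rw [← hF] at hm2
      obtain ⟨b, hb, rfl⟩ := hm2
      exact ⟨gr n ⟨b, hb⟩, ⟨_, rfl⟩, (hf n b hb).symm⟩
    · rintro _ ⟨_, ⟨⟨b, hb⟩, rfl⟩, rfl⟩
      exact ⟨_, hf n b hb⟩
  · intro n m hm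
    have hm2 := hm
    rw [← hF] at hm2
    obtain ⟨b, hb, rfl⟩ := hm2
    have h1 := hz n b hb
    rw [← hf n b hb] at h1
    exact h1
  · intro p n b m hb hm hbm
    have hm2 := hm
    rw [← hF] at hm2
    obtain ⟨c, hc, rfl⟩ := hm2
    have hbc : b * c ∈ sgFilt Bdeg (p + n) :=
      filt_smul_mem Bdeg (fun p q b hb v hv => hmul p q b v hb hv) hb hc
    have h1 := hf (p + n) (b * c) hbc
    rw [← hgrmul p n b c hb hc hbc] at h1
    have h2 : (⟨(b * c) • v, P.filt_smul_gen hbc hv⟩ : sgFilt P.deg (p + n)) =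
        ⟨b • actOn (K := K) B v c, hbm⟩ := Subtype.ext (mul_smul b c v)
    rw [h2] at h1
    refine Eq.trans ?_ h1.symm
    have h3 := hf n c hc
    change gr p ⟨b, hb⟩ • f n ⟨c • v, hm⟩ = _
    rw [h3]
    rfl

theorem GrPointModule.iso_refl {Gdeg : ℕ → Submodule K G} (Q : GrPointModule G Gdeg) :
    Q.Iso Q := ⟨LinearEquiv.refl G Q.N, fun n => by ext x; simp⟩

theorem GrPointModule.iso_iff {Gdeg : ℕ → Submodule K G} (Q Q' : GrPointModule G Gdeg) :
    Q.Iso Q' ↔ ∃ f : Q.N ≃ₗ[G] Q'.N, ∀ n x, x ∈ Q.deg n ↔ f x ∈ Q'.deg n := by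
  constructor
  · rintro ⟨f, hf⟩
    refine ⟨f, fun n x => ?_⟩
    rw [← hf n]
    constructor
    · intro hx
      exact ⟨x, hx, rfl⟩
    · rintro ⟨y, hy, hxy⟩
      rwa [← f.injective hxy]
  · rintro ⟨f, hf⟩
    refine ⟨f, fun n => ?_⟩
    ext y
    constructor
    · rintro ⟨x, hx, rfl⟩
      exact (hf n x).1 hx
    · intro hy
      refine ⟨f.symm y, (hf n _).2 (by simpa using hy), by simp⟩

theorem GrPointModule.iso_equivalence {Gdeg : ℕ → Submodule K G} :
    Equivalence (GrPointModule.Iso (K := K) (G := G) (Gdeg := Gdeg)) where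
  refl := GrPointModule.iso_refl
  symm := by
    intro Q Q' h
    rw [GrPointModule.iso_iff] at h ⊢
    obtain ⟨f, hf⟩ := h
    exact ⟨f.symm, fun n x => by rw [hf]; simp⟩
  trans := by
    intro Q Q' Q'' h h'
    rw [GrPointModule.iso_iff] at h h' ⊢
    obtain ⟨f, hf⟩ := h
    obtain ⟨g, hg⟩ := h'
    exact ⟨f.trans g, fun n x => by rw [hf, hg]; simp⟩

theorem SGPointModule.grIso_of_iso (P P' : SGPointModule Bdeg) (h : P.Iso P') : P.GrIso P' := by
  obtain ⟨f, hf⟩ := h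
  let fK : P.M ≃ₗ[K] P'.M := f.restrictScalars K
  have h1 : ∀ n, (sgFilt P.deg n).map fK.toLinearMap = sgFilt P'.deg n := by
    intro n
    simp only [sgFilt, Submodule.map_iSup]
    exact iSup_congr fun k => iSup_congr fun _ => hf k
  have h2 : ∀ n, (sgFiltPrev P.deg n).map fK.toLinearMap = sgFiltPrev P'.deg n := by
    intro n
    cases n with
    | zero => exact Submodule.map_bot _
    | succ n => exact h1 n
  have h2' : ∀ n x, x ∈ sgFiltPrev P.deg n ↔ fK x ∈ sgFiltPrev P'.deg n := by
    intro n x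
    rw [← h2 n]
    constructor
    · intro hx
      exact ⟨x, hx, rfl⟩
    · rintro ⟨y, hy, hxy⟩
      rwa [← fK.injective hxy]
  let E : ∀ n, sgFilt P.deg n ≃ₗ[K] sgFilt P'.deg n := fun n =>
    fK.ofSubmodules _ _ (h1 n)
  have h3 : ∀ n, ((sgFiltPrev P.deg n).comap (sgFilt P.deg n).subtype).map (E n).toLinearMap =
      (sgFiltPrev P'.deg n).comap (sgFilt P'.deg n).subtype := by
    intro n
    ext y
    obtain ⟨x, rfl⟩ := (E n).surjective y
    constructor
    · rintro ⟨z, hz, hzx⟩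
      rw [← hzx]
      exact (h2' n z).1 hz
    · intro hy
      exact ⟨x, (h2' n x).2 hy, rfl⟩
  refine ⟨fun n => Submodule.Quotient.equiv _ _ (E n) (h3 n), ?_⟩
  intro p n b hb m hm m' hm' heq hh1 hh2
  have e1 : (Submodule.Quotient.mk (E n ⟨m, hm⟩) : P'.GrQuot n) = Submodule.Quotient.mk ⟨m', hm'⟩ :=
    heq
  rw [Submodule.Quotient.eq] at e1
  have e2 : f m - m' ∈ sgFiltPrev P'.deg n := e1
  change (Submodule.Quotient.mk (E (p + n) ⟨b • m, hh1⟩) : P'.GrQuot (p + n)) = _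
  rw [Submodule.Quotient.eq]
  change f (b • m) - b • m' ∈ sgFiltPrev P'.deg (p + n)
  rw [map_smul, ← smul_sub]
  exact filt_smul_memPrev P'.deg P'.smul_le hb e2

/-- The degree pieces of a realization. -/
theorem exists_grQuot_equiv (P : SGPointModule Bdeg) {N : Type*} [AddCommGroup N] [Module K N]
    (D : ℕ → Submodule K N) (grM : ∀ n : ℕ, (sgFilt P.deg n) →ₗ[K] N)
    (h1 : ∀ n : ℕ, LinearMap.range (grM n) = D n)
    (h2 : ∀ (n : ℕ) (m : P.M) (hm : m ∈ sgFilt P.deg n),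
      grM n ⟨m, hm⟩ = 0 ↔ m ∈ sgFiltPrev P.deg n) (n : ℕ) :
    ∃ e : P.GrQuot n ≃ₗ[K] D n, ∀ x, (e (Submodule.Quotient.mk x) : N) = grM n x := by
  have hk : (sgFiltPrev P.deg n).comap (sgFilt P.deg n).subtype = LinearMap.ker (grM n) := by
    ext ⟨m, hm⟩
    rw [LinearMap.mem_ker, h2]
    rfl
  exact ⟨Submodule.quotEquivOfEq _ _ hk ≪≫ₗ (grM n).quotKerEquivRange ≪≫ₗ
    LinearEquiv.ofEq _ _ (h1 n), fun x => rfl⟩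

theorem grIso_of_iso_realizations (P P' : SGPointModule Bdeg)
    (Q Q' : GrPointModule G (fun p : ℕ => LinearMap.range (gr p)))
    (hQ : RealizesGr gr P Q) (hQ' : RealizesGr gr P' Q') (h : Q.Iso Q') : P.GrIso P' := by
  obtain ⟨grM, a1, a2, a3⟩ := hQ
  obtain ⟨grM', b1, b2, b3⟩ := hQ'
  obtain ⟨f, hf⟩ := h
  choose e he using exists_grQuot_equiv P Q.deg grM a1 a2
  choose e' he' using exists_grQuot_equiv P' Q'.deg grM' b1 b2
  let F : ∀ n, Q.deg n ≃ₗ[K] Q'.deg n := fun n =>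
    (f.restrictScalars K : Q.N ≃ₗ[K] Q'.N).ofSubmodules _ _ (hf n)
  have hF : ∀ n x, (F n x : Q'.N) = f x := fun n x => rfl
  have key : ∀ n x y, ((e n ≪≫ₗ F n) ≪≫ₗ (e' n).symm) (Submodule.Quotient.mk x) =
      Submodule.Quotient.mk y ↔ f (grM n x) = grM' n y := by
    intro n x y
    rw [LinearEquiv.trans_apply, LinearEquiv.symm_apply_eq, Subtype.ext_iff, he',
      LinearEquiv.trans_apply, hF, he]
  refine ⟨fun n => (e n ≪≫ₗ F n) ≪≫ₗ (e' n).symm, ?_⟩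
  intro p n b hb m hm m' hm' heq hh1 hh2
  rw [key] at heq ⊢
  rw [← a3 p n b m hb hm hh1, ← b3 p n b m' hb hm' hh2, map_smul, heq]

open DirectSum in
theorem ideal_le_of_grIso
    (hGinternal : DirectSum.IsInternal (fun p : ℕ => LinearMap.range (gr p)))
    (P P' : SGPointModule Bdeg) (h : P.GrIso P')
    (v : P.M) (hv : v ∈ P.deg 0) (hv0 : v ≠ 0) (v' : P'.M) (hv' : v' ∈ P'.deg 0) (hv0' : v' ≠ 0)
    (ψ : G →ₗ[K] ⨁ n, P.GrQuot n)
    (hψ : ∀ p (b : B) (hb : b ∈ sgFilt Bdeg p), ψ (gr p ⟨b, hb⟩) =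
        DirectSum.lof K ℕ P.GrQuot p (Submodule.Quotient.mk ⟨b • v, P.filt_smul_gen hb hv⟩))
    (ψ' : G →ₗ[K] ⨁ n, P'.GrQuot n)
    (hψ' : ∀ p (b : B) (hb : b ∈ sgFilt Bdeg p), ψ' (gr p ⟨b, hb⟩) =
        DirectSum.lof K ℕ P'.GrQuot p (Submodule.Quotient.mk ⟨b • v', P'.filt_smul_gen hb hv'⟩))
    (u : G) : ψ u = 0 ↔ ψ' u = 0 := by
  obtain ⟨g, hg⟩ := h
  have hvF : v ∈ sgFilt P.deg 0 := deg_le_sgFilt P.deg le_rfl hv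
  obtain ⟨⟨m, hm⟩, hm2⟩ := Submodule.Quotient.mk_surjective _
    (g 0 (Submodule.Quotient.mk ⟨v, hvF⟩))
  have hmd : m ∈ P'.deg 0 := by rwa [sgFilt_zero] at hm
  obtain ⟨c, hc⟩ := exists_smul_eq_of_finrank_eq_one (P'.dim_one 0)
    (x := ⟨v', hv'⟩) (by simpa [Subtype.ext_iff] using hv0') ⟨m, hmd⟩
  have hc : c • v' = m := congrArg Subtype.val hc
  have hc0 : c ≠ 0 := by
    rintro rfl
    rw [zero_smul] at hc
    subst hc
    have : g 0 (Submodule.Quotient.mk ⟨v, hvF⟩) = 0 := by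
      rw [← hm2, Submodule.Quotient.mk_eq_zero]
      exact zero_mem _
    rw [LinearEquiv.map_eq_zero_iff, Submodule.Quotient.mk_eq_zero] at this
    exact hv0 this
  let T : (⨁ n, P.GrQuot n) ≃ₗ[K] ⨁ n, P'.GrQuot n := DFinsupp.mapRange.linearEquiv g
  have hT : T.toLinearMap ∘ₗ ψ = c • ψ' := by
    apply gr_ext hGinternal
    intro p b hb
    have e1 := hg p 0 b hb v hvF m hm hm2.symm (P.filt_smul hb hvF) (P'.filt_smul hb hm)
    have e2 : T (DirectSum.lof K ℕ P.GrQuot p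
        (Submodule.Quotient.mk ⟨b • v, P.filt_smul_gen hb hv⟩)) =
        DirectSum.lof K ℕ P'.GrQuot p
          (g p (Submodule.Quotient.mk ⟨b • v, P.filt_smul_gen hb hv⟩)) :=
      DFinsupp.mapRange_single (hf := fun i => map_zero (g i))
    rw [LinearMap.comp_apply, LinearMap.smul_apply, hψ, hψ', LinearEquiv.coe_coe, e2]
    refine (congrArg (DirectSum.lof K ℕ P'.GrQuot p) e1).trans ?_
    rw [← map_smul]
    congr 1
    rw [← Submodule.Quotient.mk_smul]
    congr 1
    apply Subtype.ext
    change b • m = c • b • v'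
    rw [← hc]
    exact (actBy K P'.M b).map_smul c v'
  have h3 : T (ψ u) = c • ψ' u := LinearMap.congr_fun hT u
  rw [← LinearEquiv.map_eq_zero_iff T, h3, smul_eq_zero]
  exact or_iff_right hc0

end gr

/-- let `B` be a finitely semi-graded `K`-algebra generated in degree 1
with `B₀ = K`, and let `G` (with the maps `gr`) be a realization of the associated
graded algebra `Gr(B)`. Then the relation `[M] ∼ [M'] ⇔ Gr(M) ≅ Gr(M')` is well
defined on `P(B)` (isomorphic point modules have isomorphic associated graded modules)
and is an equivalence relation; for every point module `M` of `B` the module `Gr(M)` is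
a point module for `Gr(B)`; and the induced map `P(B)/∼ → P(Gr(B))`,
`[[M]] ↦ [Gr(M)]`, is well defined and injective. -/
theorem FSG_pointModules_inject_into_graded_pointModules
    (Bdeg : ℕ → Submodule K B)
    -- B is finitely semi-graded, generated in degree 1, with B₀ = K
    (hinternal : DirectSum.IsInternal Bdeg)
    (hmul : ∀ m n : ℕ, ∀ a b : B, a ∈ Bdeg m → b ∈ Bdeg n →
      a * b ∈ ⨆ k ∈ Set.Iic (m + n), Bdeg k)
    (hdeg0 : Bdeg 0 = Submodule.span K {(1 : B)})
    (hfin : ∀ n : ℕ, FiniteDimensional K (Bdeg n))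
    (hgen : Algebra.adjoin K (Bdeg 1 : Set B) = ⊤)
    -- G is a realization of the associated graded ring Gr(B)
    (G : Type w) [Ring G] [Algebra K G] (gr : ∀ p : ℕ, (sgFilt Bdeg p) →ₗ[K] G)
    (hGinternal : DirectSum.IsInternal (fun p : ℕ => LinearMap.range (gr p)))
    (hker : ∀ (p : ℕ) (a : B) (ha : a ∈ sgFilt Bdeg p),
      gr p ⟨a, ha⟩ = 0 ↔ a ∈ sgFiltPrev Bdeg p)
    (hgrmul : ∀ (p q : ℕ) (a b : B) (ha : a ∈ sgFilt Bdeg p) (hb : b ∈ sgFilt Bdeg q)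
      (hab : a * b ∈ sgFilt Bdeg (p + q)),
      gr p ⟨a, ha⟩ * gr q ⟨b, hb⟩ = gr (p + q) ⟨a * b, hab⟩)
    (halg : ∀ (k : K) (hk : algebraMap K B k ∈ sgFilt Bdeg 0),
      gr 0 ⟨algebraMap K B k, hk⟩ = algebraMap K G k) :
    -- ∼ is well defined on P(B)
    (∀ P P' : SGPointModule Bdeg, P.Iso P' → P.GrIso P') ∧
    -- ∼ is an equivalence relation
    Equivalence (SGPointModule.GrIso (Bdeg := Bdeg)) ∧
    -- Gr(M) is a point module for Gr(B), and [[M]] ↦ [Gr(M)] is injective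
    ∃ Φ : SGPointModule Bdeg → GrPointModule G (fun p : ℕ => LinearMap.range (gr p)),
      (∀ P : SGPointModule Bdeg, RealizesGr gr P (Φ P)) ∧
      (∀ P P' : SGPointModule Bdeg, P.GrIso P' ↔ (Φ P).Iso (Φ P')) ∧
      ∃ α : Quot (SGPointModule.GrIso (Bdeg := Bdeg)) →
          Quot (GrPointModule.Iso (K := K) (G := G)
            (Gdeg := fun p : ℕ => LinearMap.range (gr p))),
        Function.Injective α ∧
        ∀ P : SGPointModule Bdeg, α (Quot.mk _ P) = Quot.mk _ (Φ P) := by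
  have hone : (1 : G) ∈ LinearMap.range (gr 0) := by
    have h0 : algebraMap K B 1 ∈ sgFilt Bdeg 0 := by
      rw [sgFilt_zero, hdeg0, map_one]
      exact Submodule.mem_span_singleton_self 1
    exact ⟨_, (halg 1 h0).trans (map_one _)⟩
  choose v hv hcyc using fun P : SGPointModule Bdeg => P.cyclic
  have hv0 : ∀ P, v P ≠ 0 := by
    intro P h0
    have hc := hcyc P
    rw [h0] at hc
    have hsub : Subsingleton P.M := by
      rw [Submodule.span_singleton_eq_bot.2 rfl] at hc
      exact (Submodule.subsingleton_iff B).1 (subsingleton_of_bot_eq_top hc)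
    have := P.dim_one 0
    rw [Module.finrank_zero_of_subsingleton] at this
    exact zero_ne_one this
  have hF : ∀ P n, (sgFilt Bdeg n).map (actOn B (v P)) = sgFilt P.deg n := fun P n =>
    filt_eq_map P.deg P.internal P.smul_le P.dim_one hmul hdeg0 hgen (hv P) (hcyc P) n
  choose ψ hsurj hψ using fun P => exists_psi hGinternal hker P (v P) (hv P) (hF P)
  choose J hJ using fun P => exists_ideal hmul hGinternal hgrmul P (v P) (hv P) (ψ P) (hψ P)
  let Φ : SGPointModule Bdeg → GrPointModule G (fun p : ℕ => LinearMap.range (gr p)) := fun P =>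
    mkGr hmul hgrmul hone P (v P) (hv P) (hF P) (ψ P) (hsurj P) (hψ P) (J P) (hJ P)
  have hR : ∀ P, RealizesGr gr P (Φ P) := fun P =>
    mkGr_realizes hmul hgrmul hone P (v P) (hv P) (hF P) (ψ P) (hsurj P) (hψ P) (J P) (hJ P)
  have hiff : ∀ P P' : SGPointModule Bdeg, P.GrIso P' ↔ (Φ P).Iso (Φ P') := by
    intro P P'
    constructor
    · intro h
      have hJJ : J P = J P' := by
        ext u
        rw [hJ, hJ]
        exact ideal_le_of_grIso hGinternal P P' h (v P) (hv P) (hv0 P) (v P') (hv P') (hv0 P')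
          (ψ P) (hψ P) (ψ P') (hψ P') u
      let f : (G ⧸ J P) ≃ₗ[G] (G ⧸ J P') := Submodule.quotEquivOfEq _ _ hJJ
      refine ⟨f, fun n => ?_⟩
      apply le_antisymm
      · rintro _ ⟨_, ⟨x, hx, rfl⟩, rfl⟩
        exact ⟨x, hx, rfl⟩
      · rintro _ ⟨x, hx, rfl⟩
        exact ⟨_, ⟨x, hx, rfl⟩, rfl⟩
    · exact grIso_of_iso_realizations P P' (Φ P) (Φ P') (hR P) (hR P')
  have heqv := GrPointModule.iso_equivalence (K := K) (G := G)
    (Gdeg := fun p : ℕ => LinearMap.range (gr p))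
  refine ⟨SGPointModule.grIso_of_iso, ⟨?_, ?_, ?_⟩, Φ, hR, hiff, ?_⟩
  · intro P
    exact (hiff P P).2 (heqv.refl _)
  · intro P P' h
    exact (hiff _ _).2 (heqv.symm ((hiff _ _).1 h))
  · intro P P' P'' h h'
    exact (hiff _ _).2 (heqv.trans ((hiff _ _).1 h) ((hiff _ _).1 h'))
  · refine ⟨Quot.map Φ fun P P' h => (hiff P P').1 h, ?_, fun P => rfl⟩
    intro x y
    induction x using Quot.ind with
    | mk P =>
      induction y using Quot.ind with
      | mk P' =>
        intro hxy
        have h1 := Quot.eqvGen_exact hxy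
        rw [heqv.eqvGen_iff] at h1
        exact Quot.sound ((hiff P P').2 h1)

end
end

section
/- Let K be a field and let A be a skew PBW extension of K in variables x_1, …, x_n such that A is a K-algebra (k·a = a·k for all k ∈ K, a ∈ A), and let c_{i,j} ∈ K ∖ {0} (1 ≤ i < j ≤ n) be the constants with x_j x_i − c_{i,j} x_i x_j ∈ K + Kx_1 + ⋯ + Kx_n. Let F_{−1} := 0 and, for m ≥ 0, let F_m be the K-span of the monomials x^α with |α| ≤ m, and let Gr(A) := ⊕_{m≥0} F_m/F_{m−1} be the associated graded ring. Then Gr(A) is isomorphic, as an ℕ-graded K-algebra, to the multiparameter quantum affine n-space K_c[y_1, …, y_n] := K⟨y_1, …, y_n⟩/⟨y_j y_i − c_{i,j} y_i y_j : 1 ≤ i < j ≤ n⟩, graded with each y_i of degree 1. -/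
/-- The ordered monomial `x₁^{α₁} ⋯ xₙ^{αₙ}`. -/
def skewPBWMonomial {A : Type*} [Ring A] {n : ℕ} (x : Fin n → A) (α : Fin n → ℕ) : A :=
  (List.ofFn fun i => x i ^ α i).prod

/-- `F_m`, the `K`-span of the standard monomials of total degree at most `m`. -/
def skewPBWFiltK {K A : Type*} [Field K] [Ring A] [Algebra K A] {n : ℕ}
    (x : Fin n → A) (m : ℕ) : Submodule K A :=
  Submodule.span K {a | ∃ α : Fin n → ℕ, (∑ i, α i) ≤ m ∧ a = skewPBWMonomial x α}

/-- `F_{m−1}`, with `F_{−1} = 0`. -/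
def skewPBWFiltKPrev {K A : Type*} [Field K] [Ring A] [Algebra K A] {n : ℕ}
    (x : Fin n → A) : ℕ → Submodule K A
  | 0 => ⊥
  | (m + 1) => skewPBWFiltK (K := K) x m

/-- The defining relations `yⱼyᵢ = c_{ij} yᵢyⱼ` (`i < j`) of the multiparameter quantum
affine `n`-space, as a relation on the free algebra. -/
def quantumAffineRel (K : Type*) [Field K] {n : ℕ} (c : Fin n → Fin n → K)
    (a b : FreeAlgebra K (Fin n)) : Prop :=
  ∃ i j : Fin n, i < j ∧ a = FreeAlgebra.ι K j * FreeAlgebra.ι K i ∧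
    b = c i j • (FreeAlgebra.ι K i * FreeAlgebra.ι K j)

/-- The generators `yᵢ` of the multiparameter quantum affine `n`-space
`K_c[y₁,…,yₙ] = K⟨y⟩/⟨yⱼyᵢ − c_{ij}yᵢyⱼ⟩`. -/
noncomputable def quantumAffineGen (K : Type*) [Field K] {n : ℕ}
    (c : Fin n → Fin n → K) (i : Fin n) : RingQuot (quantumAffineRel K c) :=
  RingQuot.mkAlgHom K (quantumAffineRel K c) (FreeAlgebra.ι K i)

/-- The degree-`m` homogeneous component of the multiparameter quantum affine
`n`-space, spanned by the words of length `m` in the generators. -/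
noncomputable def quantumAffineDeg (K : Type*) [Field K] {n : ℕ}
    (c : Fin n → Fin n → K) (m : ℕ) : Submodule K (RingQuot (quantumAffineRel K c)) :=
  Submodule.span K
    {z | ∃ f : Fin m → Fin n, z = (List.ofFn fun t => quantumAffineGen K c (f t)).prod}

/-- The product of a word in the letters `x i`. -/
def pbwWord {B : Type*} [Ring B] {n : ℕ} (x : Fin n → B) (L : List (Fin n)) : B :=
  (L.map x).prod

/-- The sorted word of multidegree `α`. -/
def pbwSorted {n : ℕ} (α : Fin n → ℕ) : List (Fin n) :=
  (List.ofFn fun i => List.replicate (α i) i).flatten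

theorem pbwWord_sorted {B : Type*} [Ring B] {n : ℕ} (x : Fin n → B) (α : Fin n → ℕ) :
    pbwWord x (pbwSorted α) = skewPBWMonomial x α := by
  unfold pbwWord pbwSorted skewPBWMonomial
  rw [List.map_flatten, List.prod_flatten, List.map_map, List.map_ofFn]
  congr 2
  funext i
  simp

theorem pbwSorted_length {n : ℕ} (α : Fin n → ℕ) : (pbwSorted α).length = ∑ i, α i := by
  unfold pbwSorted
  rw [List.length_flatten, List.map_ofFn, List.sum_ofFn]
  simp

theorem pbwSorted_count {n : ℕ} (α : Fin n → ℕ) (i : Fin n) :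
    (pbwSorted α).count i = α i := by
  unfold pbwSorted
  rw [List.count_flatten, List.map_ofFn, List.sum_ofFn]
  simp [List.count_replicate]

theorem pbwSorted_perm {n : ℕ} (L : List (Fin n)) :
    L.Perm (pbwSorted fun i => L.count i) := by
  rw [List.perm_iff_count]
  intro i
  rw [pbwSorted_count]

/-- Straightening of words modulo a filtration. -/
theorem pbwWord_perm {K B : Type*} [Field K] [Ring B] [Algebra K B] {n : ℕ} (x : Fin n → B)
    (c : Fin n → Fin n → K) (hc : ∀ i j : Fin n, i < j → c i j ≠ 0)
    (P : ℕ → Submodule K B)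
    (h1 : ∀ (i : Fin n) (k : ℕ) (b : B), b ∈ P k → x i * b ∈ P (k + 1))
    (h2 : ∀ i j : Fin n, i < j → ∀ L : List (Fin n),
      (x j * x i - c i j • (x i * x j)) * pbwWord x L ∈ P (L.length + 2))
    {L L' : List (Fin n)} (h : L.Perm L') :
    ∃ d : K, pbwWord x L - d • pbwWord x L' ∈ P L.length := by
  induction h with
  | nil => exact ⟨1, by simp⟩
  | cons i h ih =>
    obtain ⟨d, hd⟩ := ih
    refine ⟨d, ?_⟩
    have := h1 i _ _ hd
    simpa [pbwWord, mul_sub] using this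
  | swap i j L =>
    rcases lt_trichotomy i j with hij | hij | hij
    · refine ⟨c i j, ?_⟩
      have := h2 i j hij L
      simpa [pbwWord, sub_mul, mul_assoc] using this
    · subst hij
      exact ⟨1, by simp⟩
    · refine ⟨(c j i)⁻¹, ?_⟩
      have := (P _).smul_mem (-(c j i)⁻¹) (h2 j i hij L)
      have hne := hc j i hij
      rw [show (j :: i :: L).length = L.length + 2 from rfl]
      simpa [pbwWord, sub_mul, mul_assoc, smul_sub, smul_smul, hne, neg_smul, add_comm,
        ← sub_eq_add_neg] using this
  | trans h h' ih ih' =>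
    obtain ⟨d, hd⟩ := ih
    obtain ⟨d', hd'⟩ := ih'
    refine ⟨d * d', ?_⟩
    rw [← h.length_eq] at hd'
    have := (P _).add_mem hd ((P _).smul_mem d hd')
    simpa [smul_sub, smul_smul] using this

/-- Span of the words of length at most `m`. -/
def pbwW (K : Type*) {B : Type*} [Field K] [Ring B] [Algebra K B] {n : ℕ}
    (x : Fin n → B) (m : ℕ) : Submodule K B :=
  Submodule.span K {a | ∃ L : List (Fin n), L.length ≤ m ∧ a = pbwWord x L}

theorem pbwW_word {K B : Type*} [Field K] [Ring B] [Algebra K B] {n : ℕ}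
    (x : Fin n → B) (L : List (Fin n)) (m : ℕ) (h : L.length ≤ m) : pbwWord x L ∈ pbwW K x m :=
  Submodule.subset_span ⟨L, h, rfl⟩

theorem pbwW_mul {K B : Type*} [Field K] [Ring B] [Algebra K B] {n : ℕ}
    (x : Fin n → B) (p q : ℕ) {a b : B} (ha : a ∈ pbwW K x p) (hb : b ∈ pbwW K x q) :
    a * b ∈ pbwW K x (p + q) := by
  have : pbwW K x p * pbwW K x q ≤ pbwW K x (p + q) := by
    unfold pbwW
    rw [Submodule.span_mul_span, Submodule.span_le]
    rintro _ ⟨_, ⟨L, hL, rfl⟩, _, ⟨M, hM, rfl⟩, rfl⟩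
    refine Submodule.subset_span ⟨L ++ M, by simp; omega, ?_⟩
    simp [pbwWord]
  exact this (Submodule.mul_mem_mul ha hb)

theorem pbwFilt_mono {K B : Type*} [Field K] [Ring B] [Algebra K B] {n : ℕ}
    (x : Fin n → B) {p q : ℕ} (h : p ≤ q) :
    skewPBWFiltK (K := K) x p ≤ skewPBWFiltK (K := K) x q := by
  apply Submodule.span_mono
  rintro _ ⟨α, hα, rfl⟩
  exact ⟨α, hα.trans h, rfl⟩

/-- The shifted filtration. -/
def pbwP (K : Type*) {B : Type*} [Field K] [Ring B] [Algebra K B] {n : ℕ}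
    (x : Fin n → B) : ℕ → Submodule K B
  | 0 => ⊥
  | (k + 1) => pbwW K x k

theorem pbwFilt_eq {K A : Type*} [Field K] [Ring A] [Algebra K A] {n : ℕ} (x : Fin n → A)
    (c : Fin n → Fin n → K) (hc : ∀ i j : Fin n, i < j → c i j ≠ 0)
    (hrel : ∀ i j : Fin n, i < j →
      x j * x i - c i j • (x i * x j) ∈
        Submodule.span K ({(1 : A)} ∪ Set.range x)) (m : ℕ) :
    skewPBWFiltK (K := K) x m = pbwW K x m := by
  have hx : ∀ i, x i ∈ pbwW K x 1 := fun i => by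
    simpa [pbwWord] using pbwW_word (K := K) x [i] 1 (by simp)
  apply le_antisymm
  · apply Submodule.span_le.2
    rintro _ ⟨α, hα, rfl⟩
    rw [← pbwWord_sorted]
    exact pbwW_word x _ _ (by rw [pbwSorted_length]; exact hα)
  have key : ∀ L : List (Fin n), ∃ d : K,
      pbwWord x L - d • skewPBWMonomial x (fun i => L.count i) ∈ pbwP K x L.length := by
    intro L
    rw [← pbwWord_sorted]
    apply pbwWord_perm x c hc (pbwP K x) _ _ (pbwSorted_perm L)
    · rintro i (_ | k) b hb
      · have : b = 0 := by simpa [pbwP] using hb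
        simp [this]
      · have := pbwW_mul x 1 k (hx i) hb
        rwa [add_comm] at this
    · intro i j hij L
      have h1 : x j * x i - c i j • (x i * x j) ∈ pbwW K x 1 := by
        refine Submodule.span_le.2 ?_ (hrel i j hij)
        rintro _ (rfl | ⟨i, rfl⟩)
        · simpa [pbwWord] using pbwW_word (K := K) x [] 1 (by simp)
        · exact hx i
      have := pbwW_mul x 1 _ h1 (pbwW_word x L _ le_rfl)
      rwa [add_comm] at this
  have hlen : ∀ L : List (Fin n), ∑ i, L.count i = L.length := by
    intro L
    rw [← pbwSorted_length, (pbwSorted_perm L).length_eq]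
  induction m with
  | zero =>
    apply Submodule.span_le.2
    rintro _ ⟨L, hL, rfl⟩
    have hL : L = [] := by simpa using hL
    subst hL
    refine Submodule.subset_span ⟨fun _ => 0, by simp, ?_⟩
    simp [pbwWord, skewPBWMonomial]
  | succ m ih =>
    apply Submodule.span_le.2
    rintro _ ⟨L, hL, rfl⟩
    rcases Nat.lt_or_ge m L.length with h | h
    · have h : L.length = m + 1 := by omega
      obtain ⟨d, hd⟩ := key L
      rw [h] at hd
      have h3 : skewPBWMonomial x (fun i => L.count i) ∈ skewPBWFiltK (K := K) x (m + 1) :=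
        Submodule.subset_span ⟨_, by rw [hlen]; omega, rfl⟩
      have := Submodule.add_mem _ (pbwFilt_mono x (Nat.le_succ m) (ih hd))
        (Submodule.smul_mem _ d h3)
      simpa using this
    · exact pbwFilt_mono x (Nat.le_succ m) (ih (pbwW_word x L m h))

theorem pbwQ_span {K : Type*} [Field K] {n : ℕ} (c : Fin n → Fin n → K)
    (hc : ∀ i j : Fin n, i < j → c i j ≠ 0) :
    Submodule.span K (Set.range (skewPBWMonomial (quantumAffineGen K c))) = ⊤ := by
  have h0 : ∀ i j, i < j → quantumAffineGen K c j * quantumAffineGen K c i =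
      c i j • (quantumAffineGen K c i * quantumAffineGen K c j) := by
    intro i j hij
    have := RingQuot.mkAlgHom_rel K (s := quantumAffineRel K c) ⟨i, j, hij, rfl, rfl⟩
    simpa [quantumAffineGen] using this
  have hw : ∀ L, pbwWord (quantumAffineGen K c) L ∈
      Submodule.span K (Set.range (skewPBWMonomial (quantumAffineGen K c))) := by
    intro L
    obtain ⟨d, hd⟩ := pbwWord_perm (quantumAffineGen K c) c hc (fun _ => ⊥)
      (by simp) (by intro i j hij L; simp [h0 i j hij]) (pbwSorted_perm L)
    rw [Submodule.mem_bot, sub_eq_zero] at hd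
    rw [hd, pbwWord_sorted]
    exact Submodule.smul_mem _ _ (Submodule.subset_span ⟨_, rfl⟩)
  have hwspan : Submodule.span K (Set.range (pbwWord (quantumAffineGen K c))) = ⊤ := by
    rw [eq_top_iff]
    rintro q -
    obtain ⟨a, rfl⟩ := RingQuot.mkAlgHom_surjective K (quantumAffineRel K c) q
    induction a using FreeAlgebra.induction with
    | grade0 r =>
      rw [AlgHom.commutes, Algebra.algebraMap_eq_smul_one]
      exact Submodule.smul_mem _ _ (Submodule.subset_span ⟨[], by simp [pbwWord]⟩)
    | grade1 i => exact Submodule.subset_span ⟨[i], by simp [pbwWord, quantumAffineGen]⟩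
    | mul a b ha hb =>
      rw [map_mul]
      have := Submodule.mul_mem_mul ha hb
      rw [Submodule.span_mul_span] at this
      refine Submodule.span_mono ?_ this
      rintro _ ⟨_, ⟨L, rfl⟩, _, ⟨M, rfl⟩, rfl⟩
      exact ⟨L ++ M, by simp [pbwWord]⟩
    | add a b ha hb =>
      rw [map_add]
      exact Submodule.add_mem _ ha hb
  rw [eq_top_iff, ← hwspan, Submodule.span_le]
  rintro _ ⟨L, rfl⟩
  exact hw L

theorem pbwGr_li {K A : Type*} [Field K] [Ring A] [Algebra K A] {n : ℕ} (x : Fin n → A)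
    (hli : LinearIndependent K (skewPBWMonomial x))
    (G : Type*) [Ring G] [Algebra K G] (gr : ∀ m : ℕ, (skewPBWFiltK (K := K) x m) →ₗ[K] G)
    (hGinternal : DirectSum.IsInternal (fun m : ℕ => LinearMap.range (gr m)))
    (hker : ∀ (m : ℕ) (a : A) (ha : a ∈ skewPBWFiltK (K := K) x m),
      gr m ⟨a, ha⟩ = 0 → a ∈ skewPBWFiltKPrev (K := K) x m)
    (hm : ∀ α, skewPBWMonomial x α ∈ skewPBWFiltK (K := K) x (∑ i, α i)) :
    LinearIndependent K (fun α : Fin n → ℕ => gr (∑ i, α i) ⟨skewPBWMonomial x α, hm α⟩) := by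
  classical
  rw [linearIndependent_iff']
  intro s g hg α hα
  have hind := hGinternal.submodule_iSupIndep
  rw [iSupIndep_iff_finsetSum_eq_zero_imp_eq_zero] at hind
  have hmem : ∀ m, ∀ α : Fin n → ℕ, ∑ i, α i = m →
      skewPBWMonomial x α ∈ skewPBWFiltK (K := K) x m := fun m α h => h ▸ hm α
  -- the degree m part upstairs
  have hpart : ∀ m, ∑ α ∈ s with ∑ i, α i = m, g α • skewPBWMonomial x α ∈
      skewPBWFiltK (K := K) x m := fun m =>
    Submodule.sum_mem _ fun α h => Submodule.smul_mem _ _ (hmem m α (Finset.mem_filter.1 h).2)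
  have hgrpart : ∀ m, gr m ⟨_, hpart m⟩ = ∑ α ∈ s with ∑ i, α i = m,
      g α • gr (∑ i, α i) ⟨skewPBWMonomial x α, hm α⟩ := by
    intro m
    have h1 : (⟨_, hpart m⟩ : skewPBWFiltK (K := K) x m) =
        ∑ α ∈ (s.filter fun α => ∑ i, α i = m).attach, g α.1 •
          (⟨skewPBWMonomial x α.1, hmem m α.1 (Finset.mem_filter.1 α.2).2⟩ :
            skewPBWFiltK (K := K) x m) := by
      apply Subtype.ext
      simp only [AddSubmonoidClass.coe_finset_sum, Submodule.coe_smul]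
      exact (Finset.sum_attach _ (fun α => g α • skewPBWMonomial x α)).symm
    rw [h1, map_sum, ← Finset.sum_attach (s.filter fun α => ∑ i, α i = m)]
    refine Finset.sum_congr rfl fun α _ => ?_
    rw [map_smul]
    obtain ⟨α, h⟩ := α
    obtain rfl := (Finset.mem_filter.1 h).2
    rfl
  have hzero : ∀ m ∈ s.image (fun α => ∑ i, α i), gr m ⟨_, hpart m⟩ = 0 := by
    refine hind _ _ (fun m _ => ⟨_, rfl⟩) ?_
    rw [← hg]
    simp_rw [hgrpart]
    exact Finset.sum_fiberwise_of_maps_to (fun α h => Finset.mem_image_of_mem _ h) _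
  obtain ⟨m, hmdef⟩ : ∃ m, ∑ i, α i = m := ⟨_, rfl⟩
  have h1 := hker _ _ _ (hzero m (Finset.mem_image.2 ⟨α, hα, hmdef⟩))
  have h2 : ∑ α ∈ s with ∑ i, α i = m, g α • skewPBWMonomial x α ∈
      Submodule.span K (skewPBWMonomial x '' {α | ∑ i, α i = m}) :=
    Submodule.sum_mem _ fun α h => Submodule.smul_mem _ _
      (Submodule.subset_span ⟨α, (Finset.mem_filter.1 h).2, rfl⟩)
  have h3 : skewPBWFiltKPrev (K := K) x m ≤
      Submodule.span K (skewPBWMonomial x '' {α | ∑ i, α i < m}) := by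
    clear h1 h2 hmdef
    cases m with
    | zero => exact bot_le
    | succ m =>
      apply Submodule.span_mono
      rintro _ ⟨α, hα, rfl⟩
      exact ⟨α, Nat.lt_succ_of_le hα, rfl⟩
  have h4 := Submodule.disjoint_def.1 (hli.disjoint_span_image
    (s := {α | ∑ i, α i = m}) (t := {α | ∑ i, α i < m})
    (Set.disjoint_left.2 fun β h h' => absurd h' (by simp only [Set.mem_setOf_eq] at h ⊢; omega)))
    _ h2 (h3 h1)
  exact linearIndependent_iff'.1 hli _ _ h4 α (Finset.mem_filter.2 ⟨hα, hmdef⟩)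

/-- let `A` be a skew PBW extension of a field `K` (with `A` a
`K`-algebra), with constants `c_{ij}` (`i < j`) such that
`xⱼxᵢ − c_{ij}xᵢxⱼ ∈ K + Kx₁ + ⋯ + Kxₙ`. Then the associated graded ring
`Gr(A) = ⊕_m F_m/F_{m−1}` (here: any realization `G` of it) is isomorphic, as an
ℕ-graded `K`-algebra, to the multiparameter quantum affine `n`-space
`K_c[y₁,…,yₙ]`, graded with each `yᵢ` of degree 1. -/
theorem skewPBW_assocGraded_iso_quantumAffine {K : Type u} {A : Type v} [Field K]
    [Ring A] [Algebra K A] {n : ℕ} (x : Fin n → A)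
    -- A is a skew PBW extension of K
    (hli : LinearIndependent K (skewPBWMonomial x))
    (hspan : Submodule.span K (Set.range (skewPBWMonomial x)) = ⊤)
    (c : Fin n → Fin n → K) (hc : ∀ i j : Fin n, i < j → c i j ≠ 0)
    (hrel : ∀ i j : Fin n, i < j →
      x j * x i - c i j • (x i * x j) ∈
        Submodule.span K ({(1 : A)} ∪ Set.range x))
    -- G is a realization of the associated graded ring Gr(A)
    (G : Type w) [Ring G] [Algebra K G] (gr : ∀ m : ℕ, (skewPBWFiltK (K := K) x m) →ₗ[K] G)
    (hGinternal : DirectSum.IsInternal (fun m : ℕ => LinearMap.range (gr m)))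
    (hker : ∀ (m : ℕ) (a : A) (ha : a ∈ skewPBWFiltK (K := K) x m),
      gr m ⟨a, ha⟩ = 0 ↔ a ∈ skewPBWFiltKPrev (K := K) x m)
    (hgrmul : ∀ (p q : ℕ) (a b : A) (ha : a ∈ skewPBWFiltK (K := K) x p)
      (hb : b ∈ skewPBWFiltK (K := K) x q) (hab : a * b ∈ skewPBWFiltK (K := K) x (p + q)),
      gr p ⟨a, ha⟩ * gr q ⟨b, hb⟩ = gr (p + q) ⟨a * b, hab⟩)
    (halg : ∀ (k : K) (hk : algebraMap K A k ∈ skewPBWFiltK (K := K) x 0),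
      gr 0 ⟨algebraMap K A k, hk⟩ = algebraMap K G k) :
    ∃ e : G ≃ₐ[K] RingQuot (quantumAffineRel K c),
      ∀ m : ℕ, Submodule.map e.toLinearMap (LinearMap.range (gr m)) =
        quantumAffineDeg K c m := by
  have hF := pbwFilt_eq x c hc hrel
  have hW : ∀ L m, L.length ≤ m → pbwWord x L ∈ skewPBWFiltK (K := K) x m := fun L m h => by
    rw [hF]; exact pbwW_word x L m h
  have hx : ∀ i, x i ∈ skewPBWFiltK (K := K) x 1 := fun i => by
    simpa [pbwWord] using hW [i] 1 (by simp)
  have hmul : ∀ p q a b, a ∈ skewPBWFiltK (K := K) x p → b ∈ skewPBWFiltK (K := K) x q →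
      a * b ∈ skewPBWFiltK (K := K) x (p + q) := fun p q a b ha hb => by
    rw [hF] at *; exact pbwW_mul x p q ha hb
  have hone : (1 : A) ∈ skewPBWFiltK (K := K) x 0 := by
    simpa [pbwWord] using hW [] 0 (by simp)
  have hm : ∀ α, skewPBWMonomial x α ∈ skewPBWFiltK (K := K) x (∑ i, α i) := fun α =>
    Submodule.subset_span ⟨α, le_rfl, rfl⟩
  have hgr1 : gr 0 ⟨1, hone⟩ = 1 := by
    have := halg 1 (by rw [map_one]; exact hone)
    simpa using this
  have hgrc : ∀ p q a b (ha : a ∈ skewPBWFiltK (K := K) x p)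
      (hb : b ∈ skewPBWFiltK (K := K) x q), p = q → a = b → gr p ⟨a, ha⟩ = gr q ⟨b, hb⟩ := by
    rintro p q a b ha hb rfl rfl; rfl
  let f : Fin n → G := fun i => gr 1 ⟨x i, hx i⟩
  have hf : ∀ ⦃a b⦄, quantumAffineRel K c a b → FreeAlgebra.lift K f a = FreeAlgebra.lift K f b := by
    rintro _ _ ⟨i, j, hij, rfl, rfl⟩
    simp only [map_mul, map_smul, FreeAlgebra.lift_ι_apply, f]
    have h1 := hmul 1 1 _ _ (hx j) (hx i)
    have h2 := hmul 1 1 _ _ (hx i) (hx j)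
    rw [hgrmul 1 1 _ _ _ _ h1, hgrmul 1 1 _ _ _ _ h2, ← map_smul, ← sub_eq_zero, ← map_sub]
    refine (hker (1 + 1) _ (Submodule.sub_mem _ h1 (Submodule.smul_mem _ _ h2))).2 ?_
    change _ ∈ skewPBWFiltK (K := K) x 1
    refine Submodule.span_le.2 ?_ (hrel i j hij)
    rintro _ (rfl | ⟨i, rfl⟩)
    · exact pbwFilt_mono x (Nat.zero_le 1) hone
    · exact hx i
  let φ : RingQuot (quantumAffineRel K c) →ₐ[K] G :=
    RingQuot.liftAlgHom K ⟨FreeAlgebra.lift K f, hf⟩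
  have hφ : ∀ i, φ (quantumAffineGen K c i) = gr 1 ⟨x i, hx i⟩ := by
    intro i
    simp only [φ, quantumAffineGen]
    rw [RingQuot.liftAlgHom_mkAlgHom_apply, FreeAlgebra.lift_ι_apply]
  have hφw : ∀ L, φ (pbwWord (quantumAffineGen K c) L) =
      gr L.length ⟨pbwWord x L, hW L _ le_rfl⟩ := by
    intro L
    induction L with
    | nil => simpa [pbwWord] using hgr1.symm
    | cons i L ih =>
      have h1 : pbwWord (quantumAffineGen K c) (i :: L) =
        quantumAffineGen K c i * pbwWord (quantumAffineGen K c) L := by simp [pbwWord]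
      rw [h1, map_mul, ih, hφ, hgrmul 1 _ _ _ _ _ (hmul _ _ _ _ (hx i) (hW L _ le_rfl))]
      exact hgrc _ _ _ _ _ _ (by simp [add_comm]) (by simp [pbwWord])
  have hφm : ∀ α, φ (skewPBWMonomial (quantumAffineGen K c) α) =
      gr (∑ i, α i) ⟨skewPBWMonomial x α, hm α⟩ := by
    intro α
    rw [← pbwWord_sorted, hφw]
    exact hgrc _ _ _ _ _ _ (pbwSorted_length α) (pbwWord_sorted x α)
  have hdeg : ∀ m, Submodule.map φ.toLinearMap (quantumAffineDeg K c m) =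
      LinearMap.range (gr m) := by
    intro m
    apply le_antisymm
    · unfold quantumAffineDeg
      rw [Submodule.map_span, Submodule.span_le]
      rintro _ ⟨_, ⟨t, rfl⟩, rfl⟩
      have h1 : (List.ofFn fun s => quantumAffineGen K c (t s)).prod =
          pbwWord (quantumAffineGen K c) (List.ofFn t) := by
        unfold pbwWord
        rw [List.map_ofFn]; rfl
      change φ _ ∈ _
      rw [h1, hφw]
      exact ⟨⟨_, hW (List.ofFn t) m (by simp)⟩, hgrc _ _ _ _ _ _ (by simp) rfl⟩
    · have h2 : ∀ a (ha : a ∈ pbwW K x m), gr m ⟨a, by rw [hF]; exact ha⟩ ∈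
          Submodule.map φ.toLinearMap (quantumAffineDeg K c m) := by
        intro a ha
        induction ha using Submodule.span_induction with
        | mem a h =>
          obtain ⟨L, hL, rfl⟩ := h
          rcases hL.lt_or_eq with h | rfl
          · have : gr m ⟨pbwWord x L, hW L m hL⟩ = 0 := by
              rw [hker]
              cases m with
              | zero => omega
              | succ m => exact hW L m (by omega)
            rw [this]
            exact Submodule.zero_mem _
          · refine ⟨_, Submodule.subset_span ⟨L.get, rfl⟩, ?_⟩
            have h1 : (List.ofFn fun s => quantumAffineGen K c (L.get s)).prod =
                pbwWord (quantumAffineGen K c) L := by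
              unfold pbwWord
              conv_rhs => rw [← List.ofFn_get L, List.map_ofFn]
              rfl
            rw [h1]
            exact hφw L
        | zero =>
          have : gr m ⟨0, Submodule.zero_mem _⟩ = 0 := map_zero (gr m)
          rw [this]
          exact Submodule.zero_mem _
        | add a b ha hb iha ihb =>
          have := Submodule.add_mem _ iha ihb
          rwa [← map_add] at this
        | smul r a ha iha =>
          have := Submodule.smul_mem _ r iha
          rwa [← map_smul] at this
      rintro _ ⟨⟨a, ha⟩, rfl⟩
      exact h2 a (by rw [← hF]; exact ha)
  have hsurj : Function.Surjective φ := by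
    have : LinearMap.range φ.toLinearMap = ⊤ := by
      rw [eq_top_iff, ← hGinternal.submodule_iSup_eq_top]
      refine iSup_le fun m => ?_
      rw [← hdeg m]
      exact LinearMap.map_le_range
    exact LinearMap.range_eq_top.1 this
  have hinj : Function.Injective φ := by
    have hli' := pbwGr_li x hli G gr hGinternal (fun m a ha => (hker m a ha).1) hm
    rw [injective_iff_map_eq_zero]
    intro q hq
    have hq' : q ∈ Submodule.span K (Set.range (skewPBWMonomial (quantumAffineGen K c))) := by
      rw [pbwQ_span c hc]; trivial
    obtain ⟨l, rfl⟩ := (Finsupp.mem_span_range_iff_exists_finsupp).1 hq'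
    have : l = 0 := by
      apply linearIndependent_iff.1 hli'
      rw [← hq, Finsupp.linearCombination_apply]
      simp only [Finsupp.sum, map_sum, map_smul, hφm]
    simp [this]
  refine ⟨(AlgEquiv.ofBijective φ ⟨hinj, hsurj⟩).symm, fun m => ?_⟩
  rw [← hdeg m, ← Submodule.map_comp]
  convert Submodule.map_id _
  apply LinearMap.ext
  intro q
  exact (AlgEquiv.ofBijective φ ⟨hinj, hsurj⟩).symm_apply_apply q
end

section
/- Let A be a bijective skew PBW extension of a ring R in variables x_1, …, x_n; that is, assume additionally that for each 1 ≤ i ≤ n there is a ring automorphism σ_i : R → R and an additive map δ_i : R → R satisfying δ_i(rs) = σ_i(r)δ_i(s) + δ_i(r)s and x_i r = σ_i(r) x_i + δ_i(r) for all r, s ∈ R, and that the constants c_{i,j} with 1 ≤ i < j ≤ n are invertible in R. If R is left Noetherian, then A is left Noetherian; if R is right Noetherian, then A is right Noetherian. -/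
/-- `A` is a skew PBW extension of the subring `S` with variables `x₁, …, xₙ`. -/
structure IsSkewPBWExt {A : Type*} [Ring A] (S : Subring A) {n : ℕ} (x : Fin n → A) : Prop where
  linearIndependent : LinearIndependent S (skewPBWMonomial x)
  span_top : Submodule.span S (Set.range (skewPBWMonomial x)) = ⊤
  comm_coeff : ∀ (i : Fin n) (r : S), r ≠ 0 →
    ∃ c : S, c ≠ 0 ∧ x i * (r : A) - (c : A) * x i ∈ (S : Set A)
  comm_var : ∀ i j : Fin n, ∃ c : S, c ≠ 0 ∧ ∃ (r₀ : S) (r : Fin n → S),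
    x j * x i - (c : A) * (x i * x j) = (r₀ : A) + ∑ k, (r k : A) * x k

/-- Uniform stabilization of a monotone doubly indexed family in a Noetherian order. -/
theorem skewPBW_stab {P X : Type*} [PartialOrder P] [WellFoundedGT P] [Preorder X]
    [WellQuasiOrderedLE X]
    (f : ℕ → X → P) (h1 : ∀ k, Monotone (f k)) (h2 : ∀ a, Monotone fun k => f k a) :
    ∃ K, ∀ k, K ≤ k → ∀ a, f K a = f k a := by
  by_contra hcon
  push Not at hcon
  choose nx hnx a ha using hcon
  let s : ℕ → ℕ := fun j => nx^[j] 0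
  have hs : ∀ j, s (j + 1) = nx (s j) := fun j => Function.iterate_succ_apply' nx j 0
  have hsm : Monotone s := monotone_nat_of_le_succ fun j => by rw [hs]; exact hnx _
  obtain ⟨g, hg⟩ := (wellQuasiOrdered_le (α := X)).exists_monotone_subseq (fun j => a (s j))
  have hlt : StrictMono fun j => f (s (g j)) (a (s (g j))) := by
    apply strictMono_nat_of_lt_succ
    intro j
    have e1 : f (s (g j)) (a (s (g j))) < f (s (g j + 1)) (a (s (g j))) := by
      refine lt_of_le_of_ne (h2 _ (hsm (Nat.le_succ _))) ?_
      rw [hs]; exact ha _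
    have e2 : f (s (g j + 1)) (a (s (g j))) ≤ f (s (g (j+1))) (a (s (g j))) :=
      h2 _ (hsm (g.strictMono (Nat.lt_succ_self j)))
    exact e1.trans_le (e2.trans (h1 _ (hg _ _ (Nat.le_succ j))))
  obtain ⟨N, hN⟩ := WellFoundedGT.monotone_chain_condition ⟨_, hlt.monotone⟩
  exact (hlt (Nat.lt_succ_self N)).ne (hN (N + 1) (Nat.le_succ N))

/-- Ideal of leading coefficients. -/
def skewPBWLead {B T : Type*} [Ring B] [Ring T] (ι : T →+* B) {X : Type*}
    (m : X → B) (G : X → AddSubgroup B)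
    (hR : ∀ α r, ∀ f ∈ G α, f * ι r ∈ G α)
    (H1 : ∀ α s, ∃ s', s' * m α - m α * ι s ∈ G α ∧ ∀ f ∈ G α, s' * f ∈ G α)
    (I : Ideal B) (α : X) : Ideal T where
  carrier := {r | ∃ f ∈ I, f - m α * ι r ∈ G α}
  zero_mem' := ⟨0, I.zero_mem, by simp [(G α).zero_mem]⟩
  add_mem' := by
    rintro r s ⟨f, hf, hf'⟩ ⟨g, hg, hg'⟩
    refine ⟨f + g, I.add_mem hf hg, ?_⟩
    have := (G α).add_mem hf' hg'
    rw [map_add, mul_add]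
    convert this using 1
    abel
  smul_mem' := by
    rintro s r ⟨f, hf, hf'⟩
    obtain ⟨s', h1, h2⟩ := H1 α s
    refine ⟨s' * f, I.mul_mem_left _ hf, ?_⟩
    have := (G α).add_mem (h2 _ hf') (hR α r _ h1)
    convert this using 1
    rw [smul_eq_mul, map_mul]
    noncomm_ring

theorem skewPBW_abstract {B T : Type*} [Ring B] [Ring T] [IsNoetherianRing T] (ι : T →+* B)
    {X : Type*} [Preorder X] [WellQuasiOrderedLE X]
    {lt : X → X → Prop} (wf : WellFounded lt)
    (m : X → B) (G : X → AddSubgroup B)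
    (hR : ∀ α r, ∀ f ∈ G α, f * ι r ∈ G α)
    (H1 : ∀ α s, ∃ s', s' * m α - m α * ι s ∈ G α ∧ ∀ f ∈ G α, s' * f ∈ G α)
    (H2 : ∀ α β, α ≤ β → ∃ b, b * m α - m β ∈ G β ∧ ∀ f ∈ G α, b * f ∈ G β)
    (H3 : ∀ α, ∀ f ∈ G α, f = 0 ∨ ∃ β, lt β α ∧ ∃ r, f - m β * ι r ∈ G β)
    (H4 : ∀ f : B, f = 0 ∨ ∃ β r, f - m β * ι r ∈ G β) : IsNoetherianRing B := by
  have key : ∀ I J : Ideal B, I ≤ J → (∀ α, skewPBWLead ι m G hR H1 I α =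
      skewPBWLead ι m G hR H1 J α) → I = J := by
    intro I J hIJ hL
    have step : ∀ β r f, f ∈ J → f - m β * ι r ∈ G β → ∃ g ∈ I, f - g ∈ G β := by
      intro β r f hf hfr
      have : r ∈ skewPBWLead ι m G hR H1 J β := ⟨f, hf, hfr⟩
      rw [← hL] at this
      obtain ⟨g, hg, hgr⟩ := this
      refine ⟨g, hg, ?_⟩
      have := (G β).sub_mem hfr hgr
      convert this using 1
      abel
    have main : ∀ α, ∀ f ∈ J, f ∈ G α → f ∈ I := by
      intro α
      induction α using wf.induction with
      | _ α ih =>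
        intro f hf hfG
        rcases H3 α f hfG with rfl | ⟨β, hβ, r, hr⟩
        · exact I.zero_mem
        · obtain ⟨g, hg, hfg⟩ := step β r f hf hr
          have := ih β hβ (f - g) (J.sub_mem hf (hIJ hg)) hfg
          have := I.add_mem this hg
          simpa using this
    refine le_antisymm hIJ fun f hf => ?_
    rcases H4 f with rfl | ⟨β, r, hr⟩
    · exact I.zero_mem
    · obtain ⟨g, hg, hfg⟩ := step β r f hf hr
      have := main β (f - g) (J.sub_mem hf (hIJ hg)) hfg
      have := I.add_mem this hg
      simpa using this
  rw [isNoetherianRing_iff, ← monotone_stabilizes_iff_noetherian]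
  intro I
  obtain ⟨K, hK⟩ := skewPBW_stab (fun k α => skewPBWLead ι m G hR H1 (I k) α)
    (by
      intro k α β hαβ r
      rintro ⟨f, hf, hfr⟩
      obtain ⟨b, hb, hb'⟩ := H2 α β hαβ
      refine ⟨b * f, (I k).smul_mem _ hf, ?_⟩
      have := (G β).add_mem (hb' _ hfr) (hR β r _ hb)
      convert this using 1
      noncomm_ring)
    (by
      intro α k l hkl r
      rintro ⟨f, hf, hfr⟩
      exact ⟨f, I.monotone hkl hf, hfr⟩)
  exact ⟨K, fun k hk => key _ _ (I.monotone hk) (hK k hk)⟩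

section concrete

variable {A : Type*} [Ring A] (S : Subring A) {n : ℕ} (x : Fin n → A)

/-- A word in the variables. -/
def skewPBWWord (l : List (Fin n)) : A := (l.map x).prod

/-- Span of words of length `< d`. -/
def skewPBWE (d : ℕ) : Submodule S A :=
  Submodule.span S (skewPBWWord x '' {l | l.length < d})

variable {S x}

theorem skewPBWWord_cons (i : Fin n) (l : List (Fin n)) :
    skewPBWWord x (i :: l) = x i * skewPBWWord x l := by simp [skewPBWWord]

theorem skewPBWWord_append (l l' : List (Fin n)) :
    skewPBWWord x (l ++ l') = skewPBWWord x l * skewPBWWord x l' := by simp [skewPBWWord]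

theorem skewPBWE_word {l : List (Fin n)} {d : ℕ} (h : l.length < d) :
    skewPBWWord x l ∈ skewPBWE S x d := Submodule.subset_span ⟨l, h, rfl⟩

theorem skewPBWE_mono {d e : ℕ} (h : d ≤ e) : skewPBWE S x d ≤ skewPBWE S x e :=
  Submodule.span_mono (Set.image_mono fun _ (hl : _ < _) => lt_of_lt_of_le hl h)

theorem skewPBW_smul {N : Submodule S A} (s : S) {f : A} (hf : f ∈ N) : (s : A) * f ∈ N :=
  N.smul_mem s hf

theorem skewPBWE_mul_word {d : ℕ} {f : A} (hf : f ∈ skewPBWE S x d) (l : List (Fin n)) :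
    f * skewPBWWord x l ∈ skewPBWE S x (d + l.length) := by
  induction hf using Submodule.span_induction with
  | mem f hf =>
    obtain ⟨l', hl', rfl⟩ := hf
    rw [← skewPBWWord_append]
    apply skewPBWE_word
    simp at hl' ⊢; omega
  | zero => simp
  | add f g _ _ hf hg => rw [add_mul]; exact add_mem hf hg
  | smul s f _ hf => rw [smul_mul_assoc]; exact Submodule.smul_mem _ _ hf

theorem skewPBWE_x_mul
    (hσ : ∀ i : Fin n, ∃ (σ : S ≃+* S) (δ : S →+ S),
      ∀ r : S, x i * (r : A) = ((σ r : S) : A) * x i + (δ r : A))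
    {d : ℕ} {f : A} (hf : f ∈ skewPBWE S x d) (i : Fin n) :
    x i * f ∈ skewPBWE S x (d + 1) := by
  induction hf using Submodule.closure_induction with
  | zero => simp
  | add f g _ _ hf hg => rw [mul_add]; exact add_mem hf hg
  | smul_mem s f hf =>
    obtain ⟨l, hl, rfl⟩ := hf
    obtain ⟨σ, δ, h⟩ := hσ i
    simp at hl
    rw [Subring.smul_def, smul_eq_mul, ← mul_assoc, h, add_mul, mul_assoc, ← skewPBWWord_cons]
    exact add_mem (skewPBW_smul _ (skewPBWE_word (by simp; omega)))
      (skewPBW_smul _ (skewPBWE_word (by omega)))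

theorem skewPBW_word_coeff
    (hσ : ∀ i : Fin n, ∃ (σ : S ≃+* S) (δ : S →+ S),
      ∀ r : S, x i * (r : A) = ((σ r : S) : A) * x i + (δ r : A)) (l : List (Fin n)) :
    ∃ σ : S ≃+* S, ∀ r : S,
      skewPBWWord x l * (r : A) - (σ r : A) * skewPBWWord x l ∈ skewPBWE S x l.length := by
  induction l with
  | nil => exact ⟨RingEquiv.refl S, fun r => by simp [skewPBWWord]⟩
  | cons i l ih =>
    obtain ⟨τ, hτ⟩ := ih
    obtain ⟨σ, δ, h⟩ := hσ i
    refine ⟨τ.trans σ, fun r => ?_⟩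
    have h1 := skewPBWE_x_mul hσ (hτ r) i
    have h2 : (δ (τ r) : A) * skewPBWWord x l ∈ skewPBWE S x (l.length + 1) :=
      skewPBW_smul _ (skewPBWE_word (by omega))
    have h3 := add_mem h1 h2
    rw [List.length_cons]
    convert h3 using 1
    rw [skewPBWWord_cons, mul_sub, ← mul_assoc (x i) (τ r : A), h]
    simp only [RingEquiv.trans_apply]
    noncomm_ring

theorem skewPBW_perm
    (hσ : ∀ i : Fin n, ∃ (σ : S ≃+* S) (δ : S →+ S),
      ∀ r : S, x i * (r : A) = ((σ r : S) : A) * x i + (δ r : A))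
    (hc : ∀ i j : Fin n, i < j → ∃ c : S, IsUnit c ∧ ∃ (r₀ : S) (r : Fin n → S),
      x j * x i - (c : A) * (x i * x j) = (r₀ : A) + ∑ k, (r k : A) * x k)
    {l l' : List (Fin n)} (hl : l.Perm l') :
    ∃ c : Sˣ, skewPBWWord x l - ((c : S) : A) * skewPBWWord x l' ∈ skewPBWE S x l.length := by
  induction hl with
  | nil => exact ⟨1, by simp⟩
  | @cons i l l' hl ih =>
    obtain ⟨c, hc'⟩ := ih
    obtain ⟨σ, δ, h⟩ := hσ i
    refine ⟨Units.map σ.toMonoidHom c, ?_⟩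
    have h1 := skewPBWE_x_mul hσ hc' i
    have h2 : (δ c : A) * skewPBWWord x l' ∈ skewPBWE S x (l.length + 1) :=
      skewPBW_smul _ (skewPBWE_word (by rw [hl.length_eq]; omega))
    have h3 := add_mem h1 h2
    rw [List.length_cons]
    convert h3 using 1
    rw [skewPBWWord_cons, skewPBWWord_cons, mul_sub, ← mul_assoc (x i) ((c : S) : A), h]
    simp
    noncomm_ring
  | swap i j l =>
    have base : ∀ i j : Fin n, i < j → ∃ c : Sˣ,
        skewPBWWord x (j :: i :: l) - ((c : S) : A) * skewPBWWord x (i :: j :: l)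
          ∈ skewPBWE S x (l.length + 2) := by
      intro i j hij
      obtain ⟨c, ⟨c, rfl⟩, r₀, r, h⟩ := hc i j hij
      refine ⟨c, ?_⟩
      have e : skewPBWWord x (j :: i :: l) - ((c : S) : A) * skewPBWWord x (i :: j :: l) =
          (r₀ : A) * skewPBWWord x l + ∑ k, (r k : A) * skewPBWWord x (k :: l) := by
        simp only [skewPBWWord_cons]
        have := congrArg (· * skewPBWWord x l) h
        simp only [sub_mul, add_mul, Finset.sum_mul, mul_assoc] at this
        exact this
      rw [e]
      refine add_mem (skewPBW_smul _ (skewPBWE_word (by omega))) (sum_mem fun k _ =>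
        skewPBW_smul _ (skewPBWE_word (by simp)))
    rcases lt_trichotomy i j with hij | rfl | hij
    · exact base i j hij
    · exact ⟨1, by simp⟩
    · obtain ⟨c, h⟩ := base j i hij
      refine ⟨c⁻¹, ?_⟩
      have h1 := neg_mem (skewPBW_smul ((c⁻¹ : Sˣ) : S) h)
      have hcc : (((c⁻¹ : Sˣ) : S) : A) * ((c : S) : A) = 1 := by
        rw [← Subring.coe_mul]; simp
      rw [mul_sub, ← mul_assoc, hcc, one_mul, neg_sub] at h1
      exact h1
  | @trans l1 l2 l3 h12 _ ih1 ih2 =>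
    obtain ⟨c, h1⟩ := ih1
    obtain ⟨d, h2⟩ := ih2
    refine ⟨c * d, ?_⟩
    rw [← h12.length_eq] at h2
    have := add_mem h1 (skewPBW_smul (c : S) h2)
    convert this using 1
    push_cast
    noncomm_ring

/-- Sorted list of an exponent. -/
def skewPBWList (α : Fin n → ℕ) : List (Fin n) :=
  (List.ofFn fun i => List.replicate (α i) i).flatten

theorem skewPBWWord_list (α : Fin n → ℕ) :
    skewPBWWord x (skewPBWList α) = skewPBWMonomial x α := by
  simp [skewPBWWord, skewPBWList, skewPBWMonomial, List.map_flatten, List.prod_flatten,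
    List.map_ofFn, Function.comp_def]

theorem skewPBWList_count (α : Fin n → ℕ) (i : Fin n) : (skewPBWList α).count i = α i := by
  simp [skewPBWList, List.count_flatten, List.map_ofFn, Function.comp_def, List.sum_ofFn,
    List.count_replicate]

theorem skewPBWList_length (α : Fin n → ℕ) : (skewPBWList α).length = ∑ i, α i := by
  simp [skewPBWList, List.length_flatten, List.map_ofFn, Function.comp_def, List.sum_ofFn]

/-- Degree-lexicographic key. -/
def skewPBWKey (α : Fin n → ℕ) : ℕ ×ₗ Lex (Fin n → ℕ) := toLex (∑ i, α i, toLex α)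

theorem skewPBWKey_add (α β : Fin n → ℕ) :
    skewPBWKey (α + β) = skewPBWKey α + skewPBWKey β := by
  simp [skewPBWKey, Finset.sum_add_distrib]
  rfl

theorem skewPBWKey_inj {α β : Fin n → ℕ} (h : skewPBWKey α = skewPBWKey β) : α = β := by
  have := congrArg (fun p => ofLex (ofLex p).2) h
  simpa [skewPBWKey] using this

theorem skewPBWKey_lt_of {α β : Fin n → ℕ} (h : ∑ i, α i < ∑ i, β i) :
    skewPBWKey α < skewPBWKey β := by
  rw [skewPBWKey, skewPBWKey, Prod.Lex.toLex_lt_toLex]; exact Or.inl h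

theorem skewPBWKey_deg {α β : Fin n → ℕ} (h : skewPBWKey α < skewPBWKey β) :
    ∑ i, α i ≤ ∑ i, β i := by
  rw [skewPBWKey, skewPBWKey, Prod.Lex.toLex_lt_toLex] at h
  rcases h with h | h
  · exact h.le
  · exact h.1.le

theorem skewPBWKey_wf : WellFounded fun α β : Fin n → ℕ => skewPBWKey α < skewPBWKey β :=
  InvImage.wf skewPBWKey wellFounded_lt

theorem skewPBWKey_add_lt {α β : Fin n → ℕ} (γ : Fin n → ℕ) (h : skewPBWKey α < skewPBWKey β) :
    skewPBWKey (γ + α) < skewPBWKey (γ + β) := by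
  rw [skewPBWKey_add, skewPBWKey_add]; exact add_lt_add_right h _

variable (S x) in
/-- Span of the monomials below `α`. -/
def skewPBWG (α : Fin n → ℕ) : Submodule S A :=
  Submodule.span S (skewPBWMonomial x '' {β | skewPBWKey β < skewPBWKey α})

theorem skewPBWG_mono {α β : Fin n → ℕ} (h : skewPBWKey α ≤ skewPBWKey β) :
    skewPBWG S x α ≤ skewPBWG S x β :=
  Submodule.span_mono (Set.image_mono fun _ (hl : _ < _) => lt_of_lt_of_le hl h)

theorem skewPBWG_mem {α β : Fin n → ℕ} (h : skewPBWKey α < skewPBWKey β) :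
    skewPBWMonomial x α ∈ skewPBWG S x β := Submodule.subset_span ⟨α, h, rfl⟩

theorem skewPBW_lead (P : Set (Fin n → ℕ)) {f : A}
    (hf : f ∈ Submodule.span S (skewPBWMonomial x '' P)) :
    f = 0 ∨ ∃ β ∈ P, ∃ r : S, f - (r : A) * skewPBWMonomial x β ∈ skewPBWG S x β := by
  induction hf using Submodule.span_induction with
  | mem f hf =>
    obtain ⟨β, hβ, rfl⟩ := hf
    exact Or.inr ⟨β, hβ, 1, by simp⟩
  | zero => exact Or.inl rfl
  | smul s f _ hf =>
    rcases hf with rfl | ⟨β, hβ, r, hr⟩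
    · left; simp
    · refine Or.inr ⟨β, hβ, s * r, ?_⟩
      have := skewPBW_smul s hr
      convert this using 1
      rw [Subring.smul_def, smul_eq_mul]; push_cast; noncomm_ring
  | add f g _ _ hf hg =>
    rcases hf with rfl | ⟨β, hβ, r, hr⟩
    · simpa using hg
    rcases hg with rfl | ⟨γ, hγ, s, hs⟩
    · right; exact ⟨β, hβ, r, by simpa using hr⟩
    right
    have aux : ∀ (f g : A) (β γ : Fin n → ℕ) (r s : S), skewPBWKey β < skewPBWKey γ →
        f - (r : A) * skewPBWMonomial x β ∈ skewPBWG S x β →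
        g - (s : A) * skewPBWMonomial x γ ∈ skewPBWG S x γ →
        f + g - (s : A) * skewPBWMonomial x γ ∈ skewPBWG S x γ := by
      intro f g β γ r s hlt hr hs
      have h1 := add_mem (add_mem (skewPBWG_mono hlt.le hr)
        (skewPBW_smul r (skewPBWG_mem (S := S) (x := x) hlt))) hs
      convert h1 using 1
      abel
    rcases lt_trichotomy (skewPBWKey β) (skewPBWKey γ) with hlt | heq | hlt
    · exact ⟨γ, hγ, s, aux f g β γ r s hlt hr hs⟩
    · obtain rfl := skewPBWKey_inj heq
      refine ⟨β, hβ, r + s, ?_⟩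
      convert add_mem hr hs using 1
      push_cast; noncomm_ring
    · refine ⟨β, hβ, r, ?_⟩
      rw [add_comm f g]
      exact aux g f γ β s r hlt hs hr

theorem skewPBWE_le
    (hσ : ∀ i : Fin n, ∃ (σ : S ≃+* S) (δ : S →+ S),
      ∀ r : S, x i * (r : A) = ((σ r : S) : A) * x i + (δ r : A))
    (hc : ∀ i j : Fin n, i < j → ∃ c : S, IsUnit c ∧ ∃ (r₀ : S) (r : Fin n → S),
      x j * x i - (c : A) * (x i * x j) = (r₀ : A) + ∑ k, (r k : A) * x k) (d : ℕ) :
    skewPBWE S x d ≤ Submodule.span S (skewPBWMonomial x '' {β | ∑ i, β i < d}) := by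
  induction d using Nat.strong_induction_on with
  | _ d ih =>
    refine Submodule.span_le.2 ?_
    rintro _ ⟨l, hl, rfl⟩
    simp only [Set.mem_ofPred_eq] at hl
    have hp : l.Perm (skewPBWList fun i => l.count i) := by
      rw [List.perm_iff_count]; intro i; rw [skewPBWList_count]
    obtain ⟨c, h⟩ := skewPBW_perm hσ hc hp
    have hlen := hp.length_eq
    rw [skewPBWList_length] at hlen
    rw [skewPBWWord_list] at h
    have hsub : {β : Fin n → ℕ | ∑ i, β i < l.length} ⊆ {β | ∑ i, β i < d} :=
      fun β (hβ : ∑ i, β i < l.length) => hβ.trans hl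
    have h1 := Submodule.span_mono (R := S) (Set.image_mono (f := skewPBWMonomial x) hsub)
      (ih _ hl h)
    have h2 : skewPBWMonomial x (fun i => l.count i) ∈
        Submodule.span S (skewPBWMonomial x '' {β | ∑ i, β i < d}) :=
      Submodule.subset_span ⟨_, by simp only [Set.mem_ofPred_eq]; omega, rfl⟩
    have := add_mem h1 (skewPBW_smul (c : S) h2)
    simpa using this

theorem skewPBWE_le_G
    (hσ : ∀ i : Fin n, ∃ (σ : S ≃+* S) (δ : S →+ S),
      ∀ r : S, x i * (r : A) = ((σ r : S) : A) * x i + (δ r : A))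
    (hc : ∀ i j : Fin n, i < j → ∃ c : S, IsUnit c ∧ ∃ (r₀ : S) (r : Fin n → S),
      x j * x i - (c : A) * (x i * x j) = (r₀ : A) + ∑ k, (r k : A) * x k)
    (d : ℕ) (α : Fin n → ℕ) (hd : d ≤ ∑ i, α i) :
    skewPBWE S x d ≤ skewPBWG S x α :=
  (skewPBWE_le hσ hc d).trans (Submodule.span_mono (Set.image_mono fun _ (hβ : _ < _) =>
    skewPBWKey_lt_of (hβ.trans_le hd)))

theorem skewPBW_mono_mul
    (hσ : ∀ i : Fin n, ∃ (σ : S ≃+* S) (δ : S →+ S),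
      ∀ r : S, x i * (r : A) = ((σ r : S) : A) * x i + (δ r : A))
    (hc : ∀ i j : Fin n, i < j → ∃ c : S, IsUnit c ∧ ∃ (r₀ : S) (r : Fin n → S),
      x j * x i - (c : A) * (x i * x j) = (r₀ : A) + ∑ k, (r k : A) * x k)
    (α β : Fin n → ℕ) : ∃ c : Sˣ,
    skewPBWMonomial x α * skewPBWMonomial x β - ((c : S) : A) * skewPBWMonomial x (α + β)
      ∈ skewPBWE S x (∑ i, α i + ∑ i, β i) := by
  have hp : (skewPBWList α ++ skewPBWList β).Perm (skewPBWList (α + β)) := by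
    rw [List.perm_iff_count]; intro i; simp [skewPBWList_count]
  obtain ⟨c, h⟩ := skewPBW_perm hσ hc hp
  refine ⟨c, ?_⟩
  simpa [skewPBWWord_append, skewPBWWord_list, skewPBWList_length] using h

theorem skewPBW_mono_coeff
    (hσ : ∀ i : Fin n, ∃ (σ : S ≃+* S) (δ : S →+ S),
      ∀ r : S, x i * (r : A) = ((σ r : S) : A) * x i + (δ r : A))
    (α : Fin n → ℕ) : ∃ σ : S ≃+* S, ∀ r : S,
    skewPBWMonomial x α * (r : A) - (σ r : A) * skewPBWMonomial x α
      ∈ skewPBWE S x (∑ i, α i) := by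
  obtain ⟨σ, h⟩ := skewPBW_word_coeff hσ (skewPBWList α)
  refine ⟨σ, fun r => ?_⟩
  simpa [skewPBWWord_list, skewPBWList_length] using h r

theorem skewPBWG_mul_mono
    (hσ : ∀ i : Fin n, ∃ (σ : S ≃+* S) (δ : S →+ S),
      ∀ r : S, x i * (r : A) = ((σ r : S) : A) * x i + (δ r : A))
    (hc : ∀ i j : Fin n, i < j → ∃ c : S, IsUnit c ∧ ∃ (r₀ : S) (r : Fin n → S),
      x j * x i - (c : A) * (x i * x j) = (r₀ : A) + ∑ k, (r k : A) * x k)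
    {α : Fin n → ℕ} {f : A} (hf : f ∈ skewPBWG S x α) (γ : Fin n → ℕ) :
    f * skewPBWMonomial x γ ∈ skewPBWG S x (γ + α) := by
  induction hf using Submodule.span_induction with
  | zero => simp
  | add f g _ _ hf hg => rw [add_mul]; exact add_mem hf hg
  | smul s f _ hf => rw [smul_mul_assoc]; exact Submodule.smul_mem _ _ hf
  | mem f hf =>
    obtain ⟨β, hβ, rfl⟩ := hf
    obtain ⟨c, h⟩ := skewPBW_mono_mul hσ hc β γ
    have hd := skewPBWKey_deg hβ
    have h1 := skewPBWE_le_G hσ hc _ (γ + α)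
      (by simp only [Pi.add_apply, Finset.sum_add_distrib]; omega) h
    have h2 := skewPBW_smul (c : S) (skewPBWG_mem (S := S) (x := x) (skewPBWKey_add_lt γ hβ))
    rw [add_comm γ β] at h2
    simpa using add_mem h1 h2

theorem skewPBWG_mono_mul
    (hσ : ∀ i : Fin n, ∃ (σ : S ≃+* S) (δ : S →+ S),
      ∀ r : S, x i * (r : A) = ((σ r : S) : A) * x i + (δ r : A))
    (hc : ∀ i j : Fin n, i < j → ∃ c : S, IsUnit c ∧ ∃ (r₀ : S) (r : Fin n → S),
      x j * x i - (c : A) * (x i * x j) = (r₀ : A) + ∑ k, (r k : A) * x k)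
    {α : Fin n → ℕ} {f : A} (hf : f ∈ skewPBWG S x α) (γ : Fin n → ℕ) :
    skewPBWMonomial x γ * f ∈ skewPBWG S x (γ + α) := by
  induction hf using Submodule.closure_induction with
  | zero => simp
  | add f g _ _ hf hg => rw [mul_add]; exact add_mem hf hg
  | smul_mem s f hf =>
    obtain ⟨β, hβ, rfl⟩ := hf
    obtain ⟨c, h⟩ := skewPBW_mono_mul hσ hc γ β
    obtain ⟨σ, hs⟩ := skewPBW_mono_coeff hσ γ
    have hd := skewPBWKey_deg hβ
    have hd' : ∑ i, γ i + ∑ i, β i ≤ ∑ i, (γ + α) i := by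
      simp only [Pi.add_apply, Finset.sum_add_distrib]; omega
    have h1 := skewPBWE_le_G hσ hc _ (γ + α) hd' h
    have h2 := skewPBW_smul (c : S) (skewPBWG_mem (S := S) (x := x) (skewPBWKey_add_lt γ hβ))
    have h3 := skewPBWE_mul_word (hs s) (skewPBWList β)
    rw [skewPBWList_length, skewPBWWord_list] at h3
    have h4 := skewPBWE_le_G hσ hc _ (γ + α) hd' h3
    have := add_mem h4 (skewPBW_smul (σ s) (add_mem h1 h2))
    convert this using 1
    rw [Subring.smul_def, smul_eq_mul]
    noncomm_ring

theorem skewPBWG_mul_coeff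
    (hσ : ∀ i : Fin n, ∃ (σ : S ≃+* S) (δ : S →+ S),
      ∀ r : S, x i * (r : A) = ((σ r : S) : A) * x i + (δ r : A))
    (hc : ∀ i j : Fin n, i < j → ∃ c : S, IsUnit c ∧ ∃ (r₀ : S) (r : Fin n → S),
      x j * x i - (c : A) * (x i * x j) = (r₀ : A) + ∑ k, (r k : A) * x k)
    {α : Fin n → ℕ} {f : A} (hf : f ∈ skewPBWG S x α) (s : S) :
    f * (s : A) ∈ skewPBWG S x α := by
  induction hf using Submodule.span_induction with
  | zero => simp
  | add f g _ _ hf hg => rw [add_mul]; exact add_mem hf hg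
  | smul s f _ hf => rw [smul_mul_assoc]; exact Submodule.smul_mem _ _ hf
  | mem f hf =>
    obtain ⟨β, hβ, rfl⟩ := hf
    obtain ⟨σ, hs⟩ := skewPBW_mono_coeff hσ β
    have h1 := skewPBWE_le_G hσ hc _ α (skewPBWKey_deg hβ) (hs s)
    have h2 := skewPBW_smul (σ s) (skewPBWG_mem (S := S) (x := x) hβ)
    simpa using add_mem h1 h2

theorem skewPBWG_coeff
    (hσ : ∀ i : Fin n, ∃ (σ : S ≃+* S) (δ : S →+ S),
      ∀ r : S, x i * (r : A) = ((σ r : S) : A) * x i + (δ r : A))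
    (hc : ∀ i j : Fin n, i < j → ∃ c : S, IsUnit c ∧ ∃ (r₀ : S) (r : Fin n → S),
      x j * x i - (c : A) * (x i * x j) = (r₀ : A) + ∑ k, (r k : A) * x k)
    (α : Fin n → ℕ) : ∃ σ : S ≃+* S, ∀ r : S,
    skewPBWMonomial x α * (r : A) - (σ r : A) * skewPBWMonomial x α ∈ skewPBWG S x α := by
  obtain ⟨σ, h⟩ := skewPBW_mono_coeff hσ α
  exact ⟨σ, fun r => skewPBWE_le_G hσ hc _ α le_rfl (h r)⟩

theorem skewPBWG_mul
    (hσ : ∀ i : Fin n, ∃ (σ : S ≃+* S) (δ : S →+ S),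
      ∀ r : S, x i * (r : A) = ((σ r : S) : A) * x i + (δ r : A))
    (hc : ∀ i j : Fin n, i < j → ∃ c : S, IsUnit c ∧ ∃ (r₀ : S) (r : Fin n → S),
      x j * x i - (c : A) * (x i * x j) = (r₀ : A) + ∑ k, (r k : A) * x k)
    (α β : Fin n → ℕ) : ∃ c : Sˣ,
    skewPBWMonomial x α * skewPBWMonomial x β - ((c : S) : A) * skewPBWMonomial x (α + β)
      ∈ skewPBWG S x (α + β) := by
  obtain ⟨c, h⟩ := skewPBW_mono_mul hσ hc α β
  exact ⟨c, skewPBWE_le_G hσ hc _ _ (by simp [Finset.sum_add_distrib]) h⟩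

theorem skewPBW_left
    (hσ : ∀ i : Fin n, ∃ (σ : S ≃+* S) (δ : S →+ S),
      ∀ r : S, x i * (r : A) = ((σ r : S) : A) * x i + (δ r : A))
    (hc : ∀ i j : Fin n, i < j → ∃ c : S, IsUnit c ∧ ∃ (r₀ : S) (r : Fin n → S),
      x j * x i - (c : A) * (x i * x j) = (r₀ : A) + ∑ k, (r k : A) * x k)
    (hspan : Submodule.span S (Set.range (skewPBWMonomial x)) = ⊤)
    [IsNoetherianRing S] : IsNoetherianRing A := by
  have hlead : ∀ (P : Set (Fin n → ℕ)) (f : A),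
      f ∈ Submodule.span S (skewPBWMonomial x '' P) →
      f = 0 ∨ ∃ β ∈ P, ∃ r : S, f - skewPBWMonomial x β * S.subtype r ∈ skewPBWG S x β := by
    intro P f hf
    rcases skewPBW_lead P hf with h | ⟨β, hβ, r, hr⟩
    · exact Or.inl h
    · right
      obtain ⟨σ, hs⟩ := skewPBWG_coeff hσ hc β
      refine ⟨β, hβ, σ.symm r, ?_⟩
      have := sub_mem hr (hs (σ.symm r))
      simpa using this
  refine skewPBW_abstract S.subtype skewPBWKey_wf (skewPBWMonomial x)
    (fun α => (skewPBWG S x α).toAddSubgroup) ?_ ?_ ?_ ?_ ?_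
  · intro α r f hf
    exact skewPBWG_mul_coeff hσ hc hf r
  · intro α s
    obtain ⟨σ, hs⟩ := skewPBWG_coeff hσ hc α
    refine ⟨(σ s : A), ?_, fun f hf => skewPBW_smul (N := skewPBWG S x α) (σ s) hf⟩
    have := neg_mem (hs s)
    rw [neg_sub] at this
    exact this
  · intro α β hαβ
    obtain ⟨γ, rfl⟩ : ∃ γ, β = γ + α := ⟨β - α, (tsub_add_cancel_of_le hαβ).symm⟩
    obtain ⟨c, h⟩ := skewPBWG_mul hσ hc γ α
    refine ⟨(((c⁻¹ : Sˣ) : S) : A) * skewPBWMonomial x γ, ?_, fun f hf => ?_⟩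
    · have h1 := skewPBW_smul ((c⁻¹ : Sˣ) : S) h
      have hcc : (((c⁻¹ : Sˣ) : S) : A) * ((c : S) : A) = 1 := by
        rw [← Subring.coe_mul]; simp
      rw [mul_sub, ← mul_assoc, ← mul_assoc, hcc, one_mul] at h1
      exact h1
    · rw [mul_assoc]
      exact skewPBW_smul (N := skewPBWG S x (γ + α)) _ (skewPBWG_mono_mul hσ hc hf γ)
  · intro α f hf
    exact hlead _ f hf
  · intro f
    have hf : f ∈ Submodule.span S (skewPBWMonomial x '' Set.univ) := by
      rw [Set.image_univ, hspan]; trivial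
    rcases hlead _ f hf with h | ⟨β, -, r, hr⟩
    · exact Or.inl h
    · exact Or.inr ⟨β, r, hr⟩

theorem skewPBW_right
    (hσ : ∀ i : Fin n, ∃ (σ : S ≃+* S) (δ : S →+ S),
      ∀ r : S, x i * (r : A) = ((σ r : S) : A) * x i + (δ r : A))
    (hc : ∀ i j : Fin n, i < j → ∃ c : S, IsUnit c ∧ ∃ (r₀ : S) (r : Fin n → S),
      x j * x i - (c : A) * (x i * x j) = (r₀ : A) + ∑ k, (r k : A) * x k)
    (hspan : Submodule.span S (Set.range (skewPBWMonomial x)) = ⊤)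
    [IsNoetherianRing Sᵐᵒᵖ] : IsNoetherianRing Aᵐᵒᵖ := by
  refine skewPBW_abstract (RingHom.op S.subtype) skewPBWKey_wf
    (fun α => MulOpposite.op (skewPBWMonomial x α))
    (fun α => (skewPBWG S x α).toAddSubgroup.comap
      (MulOpposite.opAddEquiv (α := A)).symm.toAddMonoidHom) ?_ ?_ ?_ ?_ ?_
  · intro α r f hf
    exact skewPBW_smul (N := skewPBWG S x α) r.unop hf
  · intro α s
    obtain ⟨σ, hs⟩ := skewPBWG_coeff hσ hc α
    refine ⟨MulOpposite.op (σ.symm s.unop : A), ?_, fun f hf =>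
      skewPBWG_mul_coeff hσ hc (f := f.unop) hf _⟩
    have := hs (σ.symm s.unop)
    rw [RingEquiv.apply_symm_apply] at this
    exact this
  · intro α β hαβ
    obtain ⟨γ, rfl⟩ : ∃ γ, β = γ + α := ⟨β - α, (tsub_add_cancel_of_le hαβ).symm⟩
    obtain ⟨c, h⟩ := skewPBWG_mul hσ hc α γ
    rw [add_comm α γ] at h
    obtain ⟨σ, hs⟩ := skewPBWG_coeff hσ hc (γ + α)
    obtain ⟨t, ht⟩ := σ.surjective ((c⁻¹ : Sˣ) : S)
    refine ⟨MulOpposite.op (skewPBWMonomial x γ * (t : A)), ?_, fun f hf => ?_⟩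
    · have h1 := skewPBW_smul (c : S) (hs t)
      have h2 := skewPBWG_mul_coeff hσ hc h t
      have hcc : ((c : S) : A) * (((c⁻¹ : Sˣ) : S) : A) = 1 := by
        rw [← Subring.coe_mul]; simp
      have h3 := add_mem h2 h1
      rw [ht, mul_sub, ← mul_assoc _ (((c⁻¹ : Sˣ) : S) : A), hcc, one_mul] at h3
      change skewPBWMonomial x α * (skewPBWMonomial x γ * (t : A)) - skewPBWMonomial x (γ + α)
        ∈ skewPBWG S x (γ + α)
      convert h3 using 1
      noncomm_ring
    · change f.unop * (skewPBWMonomial x γ * (t : A)) ∈ skewPBWG S x (γ + α)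
      rw [← mul_assoc]
      exact skewPBWG_mul_coeff hσ hc (skewPBWG_mul_mono hσ hc hf γ) t
  · intro α f hf
    rcases skewPBW_lead _ (f := f.unop) hf with h | ⟨β, hβ, r, hr⟩
    · exact Or.inl (MulOpposite.unop_injective h)
    · exact Or.inr ⟨β, hβ, MulOpposite.op r, hr⟩
  · intro f
    have hf : f.unop ∈ Submodule.span S (skewPBWMonomial x '' Set.univ) := by
      rw [Set.image_univ, hspan]; trivial
    rcases skewPBW_lead _ hf with h | ⟨β, -, r, hr⟩
    · exact Or.inl (MulOpposite.unop_injective h)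
    · exact Or.inr ⟨β, MulOpposite.op r, hr⟩

end concrete

/-- Hilbert Basis Theorem: if `A` is a bijective skew PBW extension of
`R` — each `σᵢ` is a ring automorphism of `R` (with `σᵢ`-derivation `δᵢ` and
`xᵢ r = σᵢ(r) xᵢ + δᵢ(r)`) and the constants `c_{i,j}` (`i < j`) are invertible in `R` —
then: `R` left Noetherian implies `A` left Noetherian, and `R` right Noetherian implies
`A` right Noetherian. -/
theorem skewPBW_hilbert_basis {A : Type*} [Ring A] (S : Subring A) {n : ℕ}
    (x : Fin n → A) (h : IsSkewPBWExt S x)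
    (hσ : ∀ i : Fin n, ∃ (σ : S ≃+* S) (δ : S →+ S),
      (∀ r s : S, δ (r * s) = σ r * δ s + δ r * s) ∧
      ∀ r : S, x i * (r : A) = ((σ r : S) : A) * x i + (δ r : A))
    (hc : ∀ i j : Fin n, i < j → ∃ c : S, IsUnit c ∧ ∃ (r₀ : S) (r : Fin n → S),
      x j * x i - (c : A) * (x i * x j) = (r₀ : A) + ∑ k, (r k : A) * x k) :
    (IsNoetherianRing S → IsNoetherianRing A) ∧
    (IsNoetherianRing Sᵐᵒᵖ → IsNoetherianRing Aᵐᵒᵖ) := by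
  have hσ' : ∀ i : Fin n, ∃ (σ : S ≃+* S) (δ : S →+ S),
      ∀ r : S, x i * (r : A) = ((σ r : S) : A) * x i + (δ r : A) := fun i => by
    obtain ⟨σ, δ, -, h⟩ := hσ i
    exact ⟨σ, δ, h⟩
  exact ⟨fun _ => skewPBW_left hσ' hc h.span_top, fun _ => skewPBW_right hσ' hc h.span_top⟩
end

section
/- Let K be a field, let A be a bijective skew PBW extension of a ring R in variables x_1, …, x_n (i.e., each σ_i with x_i r = σ_i(r)x_i + δ_i(r) is a ring automorphism of R and each constant c_{i,j} with i < j is invertible in R), and assume K is contained in the center of A with K ⊆ R, so that R and A are K-algebras. If R is left strongly Noetherian, i.e., for every commutative Noetherian K-algebra C the ring C ⊗_K R is left Noetherian, then A is left strongly Noetherian: for every commutative Noetherian K-algebra C, the ring C ⊗_K A is left Noetherian. -/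
open TensorProduct

namespace SkewPBWAux

/-- Multidegree of a word, in the degree-lexicographic order. -/
noncomputable def wdeg {n : ℕ} (l : List (Fin n)) : DegLex (Fin n →₀ ℕ) :=
  toDegLex (Multiset.toFinsupp (l : Multiset (Fin n)))

/-- A chosen word of given multidegree. -/
noncomputable def cw {n : ℕ} (μ : DegLex (Fin n →₀ ℕ)) : List (Fin n) :=
  (Finsupp.toMultiset (ofDegLex μ)).toList

lemma wdeg_cw {n : ℕ} (μ : DegLex (Fin n →₀ ℕ)) : wdeg (cw μ) = μ := by
  simp [wdeg, cw]

lemma wdeg_append {n : ℕ} (l l' : List (Fin n)) : wdeg (l ++ l') = wdeg l + wdeg l' := by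
  simp only [wdeg, ← toDegLex_add, ← map_add, Multiset.coe_add]

lemma wdeg_cons {n : ℕ} (i : Fin n) (l : List (Fin n)) : wdeg (i :: l) = wdeg [i] + wdeg l :=
  wdeg_append [i] l

lemma perm_of_wdeg {n : ℕ} {l l' : List (Fin n)} (h : wdeg l = wdeg l') : l.Perm l' := by
  have := Multiset.toFinsupp.injective (toDegLex_injective h)
  exact Multiset.coe_eq_coe.1 this

lemma wdeg_perm {n : ℕ} {l l' : List (Fin n)} (h : l.Perm l') : wdeg l = wdeg l' := by
  unfold wdeg
  rw [Multiset.coe_eq_coe.2 h]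

lemma wdeg_lt_of_length {n : ℕ} {l l' : List (Fin n)} (h : l.length < l'.length) :
    wdeg l < wdeg l' := by
  have key : ∀ l : List (Fin n), (ofDegLex (wdeg l)).degree = l.length := by
    intro l
    induction l with
    | nil => simp [wdeg]
    | cons i l ih =>
      rw [wdeg_cons, ofDegLex_add, map_add, ih, List.length_cons, add_comm]
      congr 1
      simp [wdeg, Multiset.toFinsupp_singleton]
  rw [Finsupp.DegLex.lt_iff]
  left
  rw [key, key]
  exact h

variable {B : Type*} [Ring B] (T : Subring B) {n : ℕ} (y : Fin n → B)

/-- The value of a word. -/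
def wv (y : Fin n → B) (l : List (Fin n)) : B := (l.map y).prod

lemma wv_cons (i : Fin n) (l : List (Fin n)) : wv y (i :: l) = y i * wv y l := by simp [wv]

lemma wv_append (l l' : List (Fin n)) : wv y (l ++ l') = wv y l * wv y l' := by simp [wv]

/-- Left span of the words with degree in `s`. -/
def W (s : Set (DegLex (Fin n →₀ ℕ))) : Submodule T B :=
  Submodule.span T {b | ∃ l : List (Fin n), wdeg l ∈ s ∧ wv y l = b}

variable {T y}

lemma mem_W {s : Set (DegLex (Fin n →₀ ℕ))} {l : List (Fin n)} (h : wdeg l ∈ s) :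
    wv y l ∈ W T y s := Submodule.subset_span ⟨l, h, rfl⟩

lemma W_mono {s s' : Set (DegLex (Fin n →₀ ℕ))} (h : s ⊆ s') : W T y s ≤ W T y s' :=
  Submodule.span_mono fun _ ⟨l, hl, e⟩ => ⟨l, h hl, e⟩

lemma T_mul_mem {s : Set (DegLex (Fin n →₀ ℕ))} {t b : B} (ht : t ∈ T) (hb : b ∈ W T y s) :
    t * b ∈ W T y s := (W T y s).smul_mem ⟨t, ht⟩ hb

lemma W_induct {s : Set (DegLex (Fin n →₀ ℕ))} {p : B → Prop} (h0 : p 0)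
    (hadd : ∀ a b, p a → p b → p (a + b))
    (hw : ∀ l, wdeg l ∈ s → ∀ t ∈ T, p (t * wv y l)) {b : B} (hb : b ∈ W T y s) : p b := by
  refine Submodule.span_induction (p := fun b _ => ∀ t ∈ T, p (t * b)) ?_ ?_ ?_ ?_ hb 1 T.one_mem
    |> fun h => by simpa using h
  · rintro _ ⟨l, hl, rfl⟩
    exact hw l hl
  · intro t _
    simpa using h0
  · intro a b _ _ ha hb t ht
    rw [mul_add]
    exact hadd _ _ (ha t ht) (hb t ht)
  · intro r a _ ha t ht
    rw [Subring.smul_def, smul_eq_mul, ← mul_assoc]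
    exact ha _ (T.mul_mem ht r.2)

variable (T y) in
/-- The hypotheses. -/
structure Hyp : Prop where
  h1 : ∀ i, ∀ t ∈ T, ∃ a ∈ T, ∃ b ∈ T, y i * t = a * y i + b
  h2 : ∀ i, ∀ t ∈ T, ∃ a ∈ T, ∃ b ∈ T, t * y i = y i * a + b
  h3 : ∀ i j, ∃ c ∈ T, ∃ r₀ ∈ T, ∃ r : Fin n → B, (∀ k, r k ∈ T) ∧
    y j * y i = c * (y i * y j) + (r₀ + ∑ k, r k * y k)
  h4 : ∀ b : B, b ∈ W T y Set.univ

variable (H : Hyp T y)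
include H

lemma var_mul_low (i : Fin n) {μ : DegLex (Fin n →₀ ℕ)} {b : B} (hb : b ∈ W T y (Set.Iio μ)) :
    y i * b ∈ W T y (Set.Iio (wdeg [i] + μ)) := by
  refine W_induct (T := T) (y := y) (s := Set.Iio μ) (p := fun b => y i * b ∈ W T y (Set.Iio (wdeg [i] + μ))) ?_ ?_ ?_ hb
  · simp
  · intro a b ha hb
    rw [mul_add]
    exact add_mem ha hb
  · intro l hl t ht
    obtain ⟨a, ha, c, hc, e⟩ := H.h1 i t ht
    rw [← mul_assoc, e, add_mul, mul_assoc, ← wv_cons]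
    have hl' : wdeg (i :: l) < wdeg [i] + μ := by
      rw [wdeg_cons]
      exact add_lt_add_right hl _
    exact add_mem (T_mul_mem ha (mem_W hl'))
      (T_mul_mem hc (mem_W (lt_trans (wdeg_lt_of_length (by simp)) hl')))

lemma word_mul_low (l : List (Fin n)) {μ : DegLex (Fin n →₀ ℕ)} {b : B}
    (hb : b ∈ W T y (Set.Iio μ)) : wv y l * b ∈ W T y (Set.Iio (wdeg l + μ)) := by
  induction l with
  | nil => 
    have h0 : wdeg ([] : List (Fin n)) + μ = μ := by
      have := wdeg_append [] (cw μ)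
      rw [List.nil_append, wdeg_cw] at this
      exact this.symm
    rw [h0]
    simpa [wv] using hb
  | cons i l ih =>
    rw [wv_cons, wdeg_cons, mul_assoc, add_assoc]
    exact var_mul_low H i ih

/-- `w t ∈ T w + lower`. -/
lemma word_mul_T (l : List (Fin n)) {t : B} (ht : t ∈ T) :
    ∃ a ∈ T, wv y l * t - a * wv y l ∈ W T y (Set.Iio (wdeg l)) := by
  induction l with
  | nil => exact ⟨t, ht, by simp [wv]⟩
  | cons i l ih =>
    obtain ⟨a, ha, hl⟩ := ih
    obtain ⟨c, hc, d, hd, e⟩ := H.h1 i a ha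
    refine ⟨c, hc, ?_⟩
    have h1 := var_mul_low H i hl
    rw [← wdeg_cons] at h1
    have h2 : d * wv y l ∈ W T y (Set.Iio (wdeg (i :: l))) :=
      T_mul_mem hd (mem_W (wdeg_lt_of_length (by simp)))
    have : wv y (i :: l) * t - c * wv y (i :: l) =
        y i * (wv y l * t - a * wv y l) + d * wv y l := by
      rw [wv_cons, mul_sub, ← mul_assoc (y i) a, e]
      noncomm_ring
    rw [this]
    exact add_mem h1 h2

/-- `t w ∈ w T + lower`. -/
lemma T_mul_word (l : List (Fin n)) : ∀ {t : B}, t ∈ T →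
    ∃ a ∈ T, t * wv y l - wv y l * a ∈ W T y (Set.Iio (wdeg l)) := by
  induction l with
  | nil => exact fun {t} ht => ⟨t, ht, by simp [wv]⟩
  | cons i l ih =>
    intro t ht
    obtain ⟨c, hc, d, hd, e⟩ := H.h2 i t ht
    obtain ⟨a, ha, hl⟩ := ih hc
    refine ⟨a, ha, ?_⟩
    have h1 := var_mul_low H i hl
    rw [← wdeg_cons] at h1
    have h2 : d * wv y l ∈ W T y (Set.Iio (wdeg (i :: l))) :=
      T_mul_mem hd (mem_W (wdeg_lt_of_length (by simp)))
    have : t * wv y (i :: l) - wv y (i :: l) * a =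
        y i * (c * wv y l - wv y l * a) + d * wv y l := by
      rw [wv_cons, ← mul_assoc t, e]
      noncomm_ring
    rw [this]
    exact add_mem h1 h2

lemma low_mul_T {μ : DegLex (Fin n →₀ ℕ)} {b t : B} (ht : t ∈ T)
    (hb : b ∈ W T y (Set.Iio μ)) : b * t ∈ W T y (Set.Iio μ) := by
  refine W_induct (T := T) (y := y) (s := Set.Iio μ) (p := fun b => b * t ∈ W T y (Set.Iio μ)) ?_ ?_ ?_ hb
  · simp
  · intro a b ha hb
    rw [add_mul]
    exact add_mem ha hb
  · intro l hl s hs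
    obtain ⟨a, ha, h⟩ := word_mul_T H l ht
    have h' := W_mono (T := T) (y := y) (Set.Iio_subset_Iio (le_of_lt hl)) h
    have := T_mul_mem hs (add_mem h' (T_mul_mem ha (mem_W hl)))
    rw [sub_add_cancel] at this
    rwa [mul_assoc]

lemma perm_word {l l' : List (Fin n)} (h : l.Perm l') :
    ∃ a ∈ T, wv y l - a * wv y l' ∈ W T y (Set.Iio (wdeg l)) := by
  induction h with
  | nil => exact ⟨1, T.one_mem, by simp⟩
  | @cons i l l' hp ih =>
    obtain ⟨a, ha, hl⟩ := ih
    obtain ⟨c, hc, d, hd, e⟩ := H.h1 i a ha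
    refine ⟨c, hc, ?_⟩
    have h1 := var_mul_low H i hl
    rw [← wdeg_cons] at h1
    have h2 : d * wv y l' ∈ W T y (Set.Iio (wdeg (i :: l))) :=
      T_mul_mem hd (mem_W (wdeg_lt_of_length (by simp [hp.length_eq])))
    have : wv y (i :: l) - c * wv y (i :: l') =
        y i * (wv y l - a * wv y l') + d * wv y l' := by
      rw [wv_cons, wv_cons, mul_sub, ← mul_assoc (y i) a, e]
      noncomm_ring
    rw [this]
    exact add_mem h1 h2
  | swap i j l =>
    obtain ⟨c, hc, r₀, hr₀, r, hr, e⟩ := H.h3 i j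
    refine ⟨c, hc, ?_⟩
    have : wv y (j :: i :: l) - c * wv y (i :: j :: l) =
        r₀ * wv y l + ∑ k, r k * wv y (k :: l) := by
      simp only [wv_cons, ← mul_assoc, ← Finset.sum_mul]
      rw [e]
      noncomm_ring
    rw [this]
    exact add_mem (T_mul_mem hr₀ (mem_W (wdeg_lt_of_length (by simp))))
      (sum_mem fun k _ => T_mul_mem (hr k) (mem_W (wdeg_lt_of_length (by simp))))
  | @trans l l' l'' h1 h2 ih1 ih2 =>
    obtain ⟨a, ha, e⟩ := ih1
    obtain ⟨a', ha', e'⟩ := ih2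
    refine ⟨a * a', T.mul_mem ha ha', ?_⟩
    rw [← wdeg_perm h1] at e'
    have := add_mem e (T_mul_mem ha e')
    convert this using 1
    noncomm_ring

lemma le_decomp {μ : DegLex (Fin n →₀ ℕ)} {b : B} (hb : b ∈ W T y (Set.Iic μ)) :
    ∃ t ∈ T, b - wv y (cw μ) * t ∈ W T y (Set.Iio μ) := by
  refine W_induct (T := T) (y := y) (s := Set.Iic μ) (p := fun b => ∃ t ∈ T, b - wv y (cw μ) * t ∈ W T y (Set.Iio μ)) ?_ ?_ ?_ hb
  · exact ⟨0, T.zero_mem, by simp⟩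
  · rintro a b ⟨t, ht, h⟩ ⟨t', ht', h'⟩
    refine ⟨t + t', T.add_mem ht ht', ?_⟩
    convert add_mem h h' using 1
    noncomm_ring
  · intro l hl t ht
    rcases (show wdeg l ≤ μ from hl).lt_or_eq with h | h
    · exact ⟨0, T.zero_mem, by simpa using T_mul_mem ht (mem_W h)⟩
    · obtain ⟨a, ha, e⟩ := perm_word H (perm_of_wdeg (h.trans (wdeg_cw μ).symm))
      obtain ⟨a', ha', e'⟩ := T_mul_word H (cw μ) (T.mul_mem ht ha)
      refine ⟨a', ha', ?_⟩
      rw [h] at e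
      rw [wdeg_cw] at e'
      convert add_mem (T_mul_mem ht e) e' using 1
      noncomm_ring

omit H in
lemma lt_exists {μ : DegLex (Fin n →₀ ℕ)} {b : B} (hb : b ∈ W T y (Set.Iio μ)) :
    b = 0 ∨ ∃ ν < μ, b ∈ W T y (Set.Iic ν) := by
  refine W_induct (T := T) (y := y) (s := Set.Iio μ) (p := fun b => b = 0 ∨ ∃ ν < μ, b ∈ W T y (Set.Iic ν)) (Or.inl rfl) ?_ ?_ hb
  · rintro a b (rfl | ⟨ν, hν, h⟩) (rfl | ⟨ν', hν', h'⟩)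
    · simp
    · exact Or.inr ⟨ν', hν', by simpa using h'⟩
    · exact Or.inr ⟨ν, hν, by simpa using h⟩
    · exact Or.inr ⟨max ν ν', max_lt hν hν', add_mem
        (W_mono (Set.Iic_subset_Iic.2 (le_max_left _ _)) h)
        (W_mono (Set.Iic_subset_Iic.2 (le_max_right _ _)) h')⟩
  · intro l hl t ht
    exact Or.inr ⟨wdeg l, hl, T_mul_mem ht (mem_W Set.self_mem_Iic)⟩

omit H in
lemma univ_exists {b : B} (hb : b ∈ W T y Set.univ) : ∃ ν, b ∈ W T y (Set.Iic ν) := by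
  refine W_induct (T := T) (y := y) (s := Set.univ) (p := fun b => ∃ ν, b ∈ W T y (Set.Iic ν)) ⟨⊥, zero_mem _⟩ ?_ ?_ hb
  · rintro a b ⟨ν, h⟩ ⟨ν', h'⟩
    exact ⟨max ν ν', add_mem
        (W_mono (Set.Iic_subset_Iic.2 (le_max_left _ _)) h)
        (W_mono (Set.Iic_subset_Iic.2 (le_max_right _ _)) h')⟩
  · intro l hl t ht
    exact ⟨wdeg l, T_mul_mem ht (mem_W Set.self_mem_Iic)⟩

/-- Leading coefficient ideals (coefficients on the right). -/
def lead (H : Hyp T y) (I : Submodule B B) (μ : DegLex (Fin n →₀ ℕ)) : Submodule T T where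
  carrier := {t | ∃ f ∈ W T y (Set.Iio μ), wv y (cw μ) * (t : B) + f ∈ I}
  zero_mem' := ⟨0, zero_mem _, by simp⟩
  add_mem' := by
    rintro a b ⟨f, hf, h⟩ ⟨f', hf', h'⟩
    refine ⟨f + f', add_mem hf hf', ?_⟩
    convert add_mem h h' using 1
    push_cast
    noncomm_ring
  smul_mem' := by
    rintro s t ⟨f, hf, h⟩
    obtain ⟨a, ha, e⟩ := word_mul_T H (cw μ) s.2
    rw [wdeg_cw] at e
    refine ⟨a * f - (wv y (cw μ) * s - a * wv y (cw μ)) * t,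
      sub_mem (T_mul_mem ha hf) (low_mul_T H t.2 e), ?_⟩
    convert I.smul_mem a h using 1
    simp only [smul_eq_mul, Subring.coe_mul]
    noncomm_ring

lemma lead_mono_left {I J : Submodule B B} (h : I ≤ J) (μ : DegLex (Fin n →₀ ℕ)) :
    lead H I μ ≤ lead H J μ := fun _ ⟨f, hf, h'⟩ => ⟨f, hf, h h'⟩

lemma lead_mono_right (I : Submodule B B) {μ ν : Fin n →₀ ℕ} (h : μ ≤ ν) :
    lead H I (toDegLex μ) ≤ lead H I (toDegLex ν) := by
  obtain ⟨γ, rfl⟩ := exists_add_of_le h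
  rintro t ⟨f, hf, hI⟩
  set g := cw (toDegLex γ) with hg
  have hdeg : wdeg (g ++ cw (toDegLex μ)) = toDegLex (μ + γ) := by
    rw [wdeg_append, hg, wdeg_cw, wdeg_cw, ← toDegLex_add, add_comm]
  obtain ⟨a, ha, e⟩ := perm_word H (perm_of_wdeg ((wdeg_cw _).trans hdeg.symm))
  rw [wdeg_cw] at e
  have h1 := word_mul_low H g hf
  rw [hg, wdeg_cw, ← toDegLex_add, add_comm γ μ, ← hg] at h1
  refine ⟨a * (wv y g * f) - (wv y (cw (toDegLex (μ + γ))) - a * wv y (g ++ cw (toDegLex μ))) * t,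
    sub_mem (T_mul_mem ha h1) (low_mul_T H t.2 e), ?_⟩
  convert I.smul_mem (a * wv y g) hI using 1
  rw [wv_append, smul_eq_mul]
  noncomm_ring

lemma le_of_lead {I J : Submodule B B} (hIJ : I ≤ J) (h : ∀ μ, lead H J μ ≤ lead H I μ) :
    J ≤ I := by
  have key : ∀ μ : DegLex (Fin n →₀ ℕ), ∀ f ∈ J, f ∈ W T y (Set.Iic μ) → f ∈ I := by
    intro μ
    induction μ using WellFoundedLT.induction with
    | ind μ ih =>
      intro f hf hW
      obtain ⟨t, ht, e⟩ := le_decomp H hW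
      obtain ⟨g, hg, hgI⟩ := h μ (x := ⟨t, ht⟩) ⟨_, e, by simpa using hf⟩
      simp only at hgI
      have h1 : f - (wv y (cw μ) * t + g) ∈ W T y (Set.Iio μ) := by
        convert sub_mem e hg using 1
        noncomm_ring
      have h2 : f - (wv y (cw μ) * t + g) ∈ I := by
        rcases lt_exists h1 with h0 | ⟨ν, hν, h3⟩
        · rw [h0]
          exact zero_mem _
        · exact ih ν hν _ (sub_mem hf (hIJ hgI)) h3
      simpa using add_mem h2 hgI
  intro f hf
  obtain ⟨ν, hν⟩ := univ_exists (H.h4 f)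
  exact key ν f hf hν

theorem noeth (hT : IsNoetherianRing T) : IsNoetherianRing B := by
  have hT' : WellFoundedGT (Submodule T T) := isNoetherian_iff'.1 hT
  refine isNoetherian_iff'.2 ?_
  rw [WellFoundedGT, isWellFounded_iff, RelEmbedding.wellFounded_iff_isEmpty]
  constructor
  intro I
  have hI : StrictMono I := fun a b hab => I.map_rel_iff.2 hab
  have hex : ∀ k, ∃ μ : Fin n →₀ ℕ,
      lead H (I k) (toDegLex μ) < lead H (I (k + 1)) (toDegLex μ) := by
    intro k
    by_contra! hcon
    refine (hI (Nat.lt_succ_self k)).not_ge (le_of_lead H (hI (Nat.lt_succ_self k)).le ?_)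
    intro μ
    by_contra hle
    exact hcon (ofDegLex μ) (lt_of_le_not_ge
      (lead_mono_left H (hI (Nat.lt_succ_self k)).le _) hle)
  choose μ hμ using hex
  obtain ⟨g, hg⟩ := (wellQuasiOrdered_le (α := Fin n →₀ ℕ)).exists_monotone_subseq μ
  have hs : StrictMono fun j => lead H (I (g j)) (toDegLex (μ (g j))) := by
    refine strictMono_nat_of_lt_succ fun j => ?_
    refine (hμ (g j)).trans_le ((lead_mono_left H (hI.monotone ?_) _).trans
      (lead_mono_right H _ (hg _ _ (Nat.le_succ j))))
    exact g.strictMono (Nat.lt_succ_self j)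
  exact not_strictMono_of_wellFoundedGT _ hs

end SkewPBWAux

/-- let `K` be a field (central in `A`, with `K ⊆ R`, so that `R` and `A`
are `K`-algebras) and let `A` be a bijective skew PBW extension of `R`. If `R` is left
strongly Noetherian (for every commutative Noetherian `K`-algebra `C` the ring
`C ⊗[K] R` is left Noetherian), then `A` is left strongly Noetherian. -/
theorem skewPBW_strongly_noetherian {K : Type u} {A : Type v} [Field K] [Ring A]
    [Algebra K A] (S : Subalgebra K A) {n : ℕ} (x : Fin n → A)
    (h : IsSkewPBWExt S.toSubring x)
    (hσ : ∀ i : Fin n, ∃ (σ : S.toSubring ≃+* S.toSubring) (δ : S.toSubring →+ S.toSubring),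
      (∀ r s : S.toSubring, δ (r * s) = σ r * δ s + δ r * s) ∧
      ∀ r : S.toSubring, x i * (r : A) = ((σ r : S.toSubring) : A) * x i + (δ r : A))
    (hc : ∀ i j : Fin n, i < j → ∃ c : S.toSubring, IsUnit c ∧
      ∃ (r₀ : S.toSubring) (r : Fin n → S.toSubring),
        x j * x i - (c : A) * (x i * x j) = (r₀ : A) + ∑ k, (r k : A) * x k)
    (hR : ∀ (C : Type w) [CommRing C] [Algebra K C],
      IsNoetherianRing C → IsNoetherianRing (C ⊗[K] S)) :
    ∀ (C : Type w) [CommRing C] [Algebra K C],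
      IsNoetherianRing C → IsNoetherianRing (C ⊗[K] A) := by
  intro C _ _ hC
  have hN := hR C hC
  let φ : C ⊗[K] S →+* C ⊗[K] A :=
    (Algebra.TensorProduct.map (AlgHom.id K C) S.val).toRingHom
  have hφ : ∀ (c : C) (s : A) (hs : s ∈ S), c ⊗ₜ[K] s ∈ φ.range := fun c s hs =>
    ⟨c ⊗ₜ[K] ⟨s, hs⟩, by simp [φ]⟩
  have hind : ∀ p : C ⊗[K] A → Prop, p 0 → (∀ a b, p a → p b → p (a + b)) →
      (∀ (c : C) (s : A), s ∈ S → p (c ⊗ₜ[K] s)) → ∀ t ∈ φ.range, p t := by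
    rintro p h0 hadd ht _ ⟨t, rfl⟩
    induction t using TensorProduct.induction_on with
    | zero => simpa using h0
    | tmul c s => simpa [φ] using ht c s s.2
    | add a b ha hb =>
      rw [map_add]
      exact hadd _ _ ha hb
  have hT : IsNoetherianRing φ.range := isNoetherianRing_range φ
  have hword : ∀ l : List (Fin n),
      SkewPBWAux.wv (fun i => (1 : C) ⊗ₜ[K] x i) l = (1 : C) ⊗ₜ[K] (l.map x).prod := by
    intro l
    induction l with
    | nil => simp [SkewPBWAux.wv, Algebra.TensorProduct.one_def]
    | cons i l ih => simp [SkewPBWAux.wv_cons, ih]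
  have hmon : ∀ α : Fin n → ℕ, ∃ l : List (Fin n), (l.map x).prod = skewPBWMonomial x α := by
    intro α
    have hsub : skewPBWMonomial x α ∈ MonoidHom.mrange (FreeMonoid.lift x) := by
      refine Submonoid.list_prod_mem _ ?_
      intro a ha
      rw [List.mem_ofFn] at ha
      obtain ⟨i, rfl⟩ := ha
      exact pow_mem (MonoidHom.mem_mrange.2 ⟨FreeMonoid.of i, by simp⟩) _
    obtain ⟨l, hl⟩ := hsub
    exact ⟨FreeMonoid.toList l, by rw [← hl, FreeMonoid.lift_apply]⟩
  refine SkewPBWAux.noeth (T := φ.range) (y := fun i => (1 : C) ⊗ₜ[K] x i) ?_ hT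
  refine ⟨?_, ?_, ?_, ?_⟩
  · intro i
    obtain ⟨σ, δ, -, hx⟩ := hσ i
    refine hind _ ⟨0, zero_mem _, 0, zero_mem _, by simp⟩ ?_ ?_
    · rintro a b ⟨a1, ha1, a2, ha2, ea⟩ ⟨b1, hb1, b2, hb2, eb⟩
      refine ⟨a1 + b1, add_mem ha1 hb1, a2 + b2, add_mem ha2 hb2, ?_⟩
      rw [mul_add, ea, eb]
      noncomm_ring
    · intro c s hs
      refine ⟨_, hφ c _ (σ ⟨s, hs⟩).2, _, hφ c _ (δ ⟨s, hs⟩).2, ?_⟩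
      have := hx ⟨s, hs⟩
      simp only at this
      simp [this, TensorProduct.tmul_add]
  · intro i
    obtain ⟨σ, δ, -, hx⟩ := hσ i
    refine hind _ ⟨0, zero_mem _, 0, zero_mem _, by simp⟩ ?_ ?_
    · rintro a b ⟨a1, ha1, a2, ha2, ea⟩ ⟨b1, hb1, b2, hb2, eb⟩
      refine ⟨a1 + b1, add_mem ha1 hb1, a2 + b2, add_mem ha2 hb2, ?_⟩
      rw [add_mul, ea, eb]
      noncomm_ring
    · intro c s hs
      refine ⟨_, hφ c _ (σ.symm ⟨s, hs⟩).2, _, neg_mem (hφ c _ (δ (σ.symm ⟨s, hs⟩)).2), ?_⟩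
      have := hx (σ.symm ⟨s, hs⟩)
      rw [RingEquiv.apply_symm_apply] at this
      simp [this, TensorProduct.tmul_add]
  · intro i j
    obtain ⟨c, -, r₀, r, e⟩ := h.comm_var i j
    refine ⟨_, hφ 1 _ c.2, _, hφ 1 _ r₀.2, fun k => (1 : C) ⊗ₜ[K] (r k : A),
      fun k => hφ 1 _ (r k).2, ?_⟩
    rw [sub_eq_iff_eq_add] at e
    simp [e, TensorProduct.tmul_add, TensorProduct.tmul_sum]
    abel
  · intro b
    induction b using TensorProduct.induction_on with
    | zero => exact zero_mem _
    | add a b ha hb => exact add_mem ha hb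
    | tmul c a =>
      have ha : a ∈ Submodule.span S.toSubring (Set.range (skewPBWMonomial x)) := by
        rw [h.span_top]
        trivial
      induction ha using Submodule.span_induction with
      | zero => simp
      | add a b _ _ ha hb =>
        rw [TensorProduct.tmul_add]
        exact add_mem ha hb
      | mem a ha =>
        obtain ⟨α, rfl⟩ := ha
        obtain ⟨l, hl⟩ := hmon α
        have := SkewPBWAux.T_mul_mem (hφ c 1 S.one_mem)
          (SkewPBWAux.mem_W (T := φ.range) (y := fun i => (1 : C) ⊗ₜ[K] x i) (Set.mem_univ (SkewPBWAux.wdeg l)))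
        rw [hword, hl] at this
        simpa using this
      | smul s a _ ha =>
        have := SkewPBWAux.T_mul_mem (hφ 1 s s.2) ha
        simpa [Subring.smul_def] using this
end

section
/- Let w = (x_1, y_1, z_1) ∈ K³ be nonzero and let G(w) be the 3×3 matrix over K with rows (−q_{12}y_1, x_1, 0), (−q_{13}z_1, 0, x_1), (0, −q_{23}z_1, y_1), so that for v ∈ K³ one has G(w)·v = 0 if and only if F(v)·w = 0. Then G(w) has rank at least 2, so its kernel has dimension at most 1; consequently, if v, v' ∈ K³ are nonzero vectors with F(v)·w = 0 and F(v')·w = 0, then v and v' are K-linearly dependent (the map σ sending [v] to the class of a kernel vector of F(v) is injective). -/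
open Matrix

/-- The matrix `F(v)` of the multilinearized relations of the multiparameter
quantum affine 3-space. -/
def quantumMatrixF {K : Type*} [Field K] (q12 q13 q23 : K) (v : Fin 3 → K) :
    Matrix (Fin 3) (Fin 3) K :=
  !![v 1, -q12 * v 0, 0;
     v 2, 0, -q13 * v 0;
     0, v 2, -q23 * v 1]

/-- The matrix `G(w)` with rows `(−q₁₂y₁, x₁, 0)`, `(−q₁₃z₁, 0, x₁)`, `(0, −q₂₃z₁, y₁)`
for `w = (x₁, y₁, z₁)`. -/
def quantumMatrixG {K : Type*} [Field K] (q12 q13 q23 : K) (w : Fin 3 → K) :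
    Matrix (Fin 3) (Fin 3) K :=
  !![-q12 * w 1, w 0, 0;
     -q13 * w 2, 0, w 0;
     0, -q23 * w 2, w 1]

/-- for nonzero `w ∈ K³`, `G(w)·v = 0 ↔ F(v)·w = 0`, `G(w)` has rank at
least 2 and kernel of dimension at most 1; hence any two nonzero `v, v'` with
`F(v)·w = 0 = F(v')·w` are linearly dependent (the map σ is injective). -/
theorem quantumAffine3_matrixG_injective {K : Type*} [Field K] (q12 q13 q23 : K)
    (hq12 : q12 ≠ 0) (hq13 : q13 ≠ 0) (hq23 : q23 ≠ 0)
    (w : Fin 3 → K) (hw : w ≠ 0) :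
    (∀ v : Fin 3 → K, (quantumMatrixG q12 q13 q23 w) *ᵥ v = 0 ↔
        (quantumMatrixF q12 q13 q23 v) *ᵥ w = 0) ∧
    2 ≤ (quantumMatrixG q12 q13 q23 w).rank ∧
    Module.finrank K (LinearMap.ker (quantumMatrixG q12 q13 q23 w).mulVecLin) ≤ 1 ∧
    (∀ v v' : Fin 3 → K, v ≠ 0 → v' ≠ 0 →
      (quantumMatrixF q12 q13 q23 v) *ᵥ w = 0 →
      (quantumMatrixF q12 q13 q23 v') *ᵥ w = 0 →
      ∃ c : K, v' = c • v) := by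
  have hG : ∀ v : Fin 3 → K, (quantumMatrixG q12 q13 q23 w) *ᵥ v = 0 ↔
      (w 0 * v 1 = q12 * w 1 * v 0 ∧ w 0 * v 2 = q13 * w 2 * v 0 ∧
        w 1 * v 2 = q23 * w 2 * v 1) := by
    intro v
    simp only [quantumMatrixG, funext_iff, Fin.forall_fin_succ, Matrix.mulVec, dotProduct,
      Fin.sum_univ_three]
    simp
    grind
  have hF : ∀ v : Fin 3 → K, (quantumMatrixF q12 q13 q23 v) *ᵥ w = 0 ↔
      (w 0 * v 1 = q12 * w 1 * v 0 ∧ w 0 * v 2 = q13 * w 2 * v 0 ∧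
        w 1 * v 2 = q23 * w 2 * v 1) := by
    intro v
    simp only [quantumMatrixF, funext_iff, Fin.forall_fin_succ, Matrix.mulVec, dotProduct,
      Fin.sum_univ_three]
    simp
    grind
  have hext : ∀ u v : Fin 3 → K, u 0 = v 0 → u 1 = v 1 → u 2 = v 2 → u = v := by
    intro u v h0 h1 h2
    funext i
    fin_cases i
    · exact h0
    · exact h1
    · exact h2
  have key : ∀ v v' : Fin 3 → K, v ≠ 0 →
      (quantumMatrixG q12 q13 q23 w) *ᵥ v = 0 →
      (quantumMatrixG q12 q13 q23 w) *ᵥ v' = 0 → ∃ c : K, v' = c • v := by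
    intro v v' hv h h'
    obtain ⟨a, b, c⟩ := (hG v).1 h
    obtain ⟨a', b', c'⟩ := (hG v').1 h'
    by_cases h0 : w 0 = 0
    · have hw12 : w 1 ≠ 0 ∨ w 2 ≠ 0 := by
        by_contra hcon
        push Not at hcon
        exact hw (hext _ _ h0 hcon.1 hcon.2)
      have v0 : v 0 = 0 := by grind
      have v0' : v' 0 = 0 := by grind
      by_cases h1 : w 1 = 0
      · have v1 : v 1 = 0 := by grind
        have v1' : v' 1 = 0 := by grind
        have v2 : v 2 ≠ 0 := fun h2 => hv (hext _ _ v0 v1 h2)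
        refine ⟨v' 2 / v 2, hext _ _ ?_ ?_ ?_⟩ <;> simp [v0, v0', v1, v1', v2]
      · have v1 : v 1 ≠ 0 := fun h2 => hv (hext _ _ v0 h2 (by
          simp only [Pi.zero_apply]; grind))
        refine ⟨v' 1 / v 1, hext _ _ ?_ ?_ ?_⟩
        · simp [v0, v0']
        · simp [v1]
        · simp only [Pi.smul_apply, smul_eq_mul]
          field_simp
          apply mul_left_cancel₀ h1
          linear_combination v 1 * c' - v' 1 * c
    · have v0 : v 0 ≠ 0 := fun h2 => hv (hext _ _ h2 (by
          simp only [Pi.zero_apply]; grind) (by simp only [Pi.zero_apply]; grind))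
      refine ⟨v' 0 / v 0, hext _ _ ?_ ?_ ?_⟩
      · simp [v0]
      · simp only [Pi.smul_apply, smul_eq_mul]
        field_simp
        apply mul_left_cancel₀ h0
        linear_combination v 0 * a' - v' 0 * a
      · simp only [Pi.smul_apply, smul_eq_mul]
        field_simp
        apply mul_left_cancel₀ h0
        linear_combination v 0 * b' - v' 0 * b
  have hker : Module.finrank K
      (LinearMap.ker (quantumMatrixG q12 q13 q23 w).mulVecLin) ≤ 1 := by
    by_cases hz : ∃ v : LinearMap.ker (quantumMatrixG q12 q13 q23 w).mulVecLin, v ≠ 0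
    · obtain ⟨v, hv⟩ := hz
      refine finrank_le_one v fun u => ?_
      obtain ⟨c, hc⟩ := key v.1 u.1 (fun h => hv (Subtype.ext h)) v.2 u.2
      exact ⟨c, Subtype.ext hc.symm⟩
    · push Not at hz
      exact finrank_le_one 0 fun u => ⟨0, by simp [hz u]⟩
  refine ⟨fun v => (hG v).trans (hF v).symm, ?_, hker, ?_⟩
  · have hrn := LinearMap.finrank_range_add_finrank_ker (quantumMatrixG q12 q13 q23 w).mulVecLin
    rw [Module.finrank_fin_fun] at hrn
    unfold Matrix.rank
    omega
  · intro v v' hv _ h h'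
    exact key v v' hv ((hG v).2 ((hF v).1 h)) ((hG v').2 ((hF v').1 h'))
end
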